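/- arXiv:0811.3047 — 4 statements merged into one kernel-verified Lean document; each statement's English description precedes it below -/
import Mathlib

section
/- Let 0 < b ≤ 1/2. There are constants c,C > 0 (depending only on b and the fixed cutoff ψ) such that for all Schwartz functions g on ℝ and all T ∈ (0,1]: c‖gψ_T‖_{B^b_{2,1}} ≤ T^{−b} ‖P_{≤T⁻¹}(gψ_T)‖_{L²(ℝ)} + Σ_{L > T⁻¹, L dyadic} L^b ‖P_L(gψ_T)‖_{L²(ℝ)} ≤ C‖gψ_T‖_{B^b_{2,1}}. -/
noncomputable section

open MeasureTheory Real
open scoped FourierTransform ENNReal Classical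

/-- The dyadic bump ψ_L built from the cutoff ψ: ψ₁ = ψ and
ψ_L(r) = ψ(r/L) − ψ(2r/L) for L ≥ 2. -/
def psiDy (ψ : ℝ → ℝ) (L r : ℝ) : ℝ := if L = 1 then ψ r else ψ (r / L) - ψ (2 * r / L)

/-- The 1d Fourier multiplier P_L with symbol ψ_L(τ). -/
def PL (ψ : ℝ → ℝ) (L : ℝ) (f : ℝ → ℂ) : ℝ → ℂ :=
  𝓕⁻ fun τ => (psiDy ψ L τ : ℂ) * 𝓕 f τ

/-- The Besov norm ‖g‖_{B^b_{2,1}} = Σ_{L≥1 dyadic} L^b ‖P_L g‖_{L²}. -/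
def Bnorm1 (ψ : ℝ → ℝ) (b : ℝ) (f : ℝ → ℂ) : ℝ≥0∞ :=
  ∑' l : ℕ, ENNReal.ofReal (((2 : ℝ) ^ l) ^ b) * eLpNorm (PL ψ ((2 : ℝ) ^ l) f) 2 volume

/-- The Besov norm ‖g‖_{B^b_{2,∞}} = sup_{L≥1 dyadic} L^b ‖P_L g‖_{L²}. -/
def BnormSup (ψ : ℝ → ℝ) (b : ℝ) (f : ℝ → ℂ) : ℝ≥0∞ :=
  ⨆ l : ℕ, ENNReal.ofReal (((2 : ℝ) ^ l) ^ b) * eLpNorm (PL ψ ((2 : ℝ) ^ l) f) 2 volume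

/-- The low-frequency projection P_{≤T⁻¹} = Σ_{1≤L≤T⁻¹ dyadic} P_L. -/
def Pleq (ψ : ℝ → ℝ) (T : ℝ) (f : ℝ → ℂ) : ℝ → ℂ :=
  fun t => ∑' l : ℕ, if (2 : ℝ) ^ l ≤ T⁻¹ then PL ψ ((2 : ℝ) ^ l) f t else 0

/-- The middle term T^{−b}‖P_{≤T⁻¹}(gψ_T)‖_{L²} + Σ_{L>T⁻¹} L^b ‖P_L(gψ_T)‖_{L²}. -/
def midTerm (ψ : ℝ → ℝ) (b T : ℝ) (f : ℝ → ℂ) : ℝ≥0∞ :=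
  ENNReal.ofReal (T ^ (-b)) * eLpNorm (Pleq ψ T f) 2 volume +
    ∑' l : ℕ, if T⁻¹ < (2 : ℝ) ^ l then
      ENNReal.ofReal (((2 : ℝ) ^ l) ^ b) * eLpNorm (PL ψ ((2 : ℝ) ^ l) f) 2 volume else 0

/-- A smooth nonnegative cutoff supported in `(-2, 2)` and equal to `1` on `[-1, 1]`. -/
structure IsDyadicCutoff (ψ : ℝ → ℝ) : Prop where
  smooth : ContDiff ℝ (⊤ : ℕ∞) ψ
  nonneg : ∀ r, 0 ≤ ψ r
  supp : Function.support ψ ⊆ Set.Ioo (-2) 2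
  one : ∀ r ∈ Set.Icc (-1 : ℝ) 1, ψ r = 1

theorem SchwartzMap.exists_eq_ofReal_mul {m : ℝ → ℝ} (hm : ContDiff ℝ (⊤ : ℕ∞) m)
    (hs : HasCompactSupport m) (F : SchwartzMap ℝ ℂ) :
    ∃ G : SchwartzMap ℝ ℂ, ∀ x, G x = (m x : ℂ) * F x := by
  have h1 : HasCompactSupport fun x => (m x : ℂ) * F x :=
    (hs.comp_left (g := fun r : ℝ => (r : ℂ)) (by simp)).mul_right
  have h2 : ContDiff ℝ (⊤ : ℕ∞) fun x => (m x : ℂ) * F x :=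
    (Complex.ofRealCLM.contDiff.comp hm).mul (F.smooth _)
  exact ⟨h1.toSchwartzMap h2, fun x => rfl⟩

theorem SchwartzMap.eLpNorm_two_fourier (G : SchwartzMap ℝ ℂ) :
    eLpNorm (𝓕 (G : ℝ → ℂ)) 2 volume = eLpNorm G 2 volume := by
  have h := G.norm_fourier_toL2_eq
  rw [SchwartzMap.norm_toLp, SchwartzMap.norm_toLp] at h
  rw [← SchwartzMap.fourier_coe]
  exact (ENNReal.toReal_eq_toReal_iff' ((𝓕 G).memLp 2 volume).2.ne (G.memLp 2 volume).2.ne).1 h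

theorem SchwartzMap.eLpNorm_two_fourierInv (G : SchwartzMap ℝ ℂ) :
    eLpNorm (𝓕⁻ (G : ℝ → ℂ)) 2 volume = eLpNorm G 2 volume := by
  have h := (𝓕⁻ G).eLpNorm_two_fourier
  rw [← SchwartzMap.fourier_coe, FourierTransform.fourier_fourierInv_eq] at h
  rw [h, SchwartzMap.fourierInv_coe]

/-- Bernstein's inequality on a set of finite measure. -/
theorem SchwartzMap.eLpNorm_two_restrict_fourierInv_le (G : SchwartzMap ℝ ℂ) {u : Set ℝ}
    (hu : Function.support G ⊆ u) (s : Set ℝ) :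
    eLpNorm (𝓕⁻ (G : ℝ → ℂ)) 2 (volume.restrict s) ≤
      volume s ^ (1 / 2 : ℝ) * (volume u ^ (1 / 2 : ℝ) * eLpNorm G 2 volume) := by
  have h1 : eLpNorm G 1 volume ≤ volume u ^ (1 / 2 : ℝ) * eLpNorm G 2 volume := by
    calc eLpNorm G 1 volume = eLpNorm G 1 (volume.restrict u) :=
          (eLpNorm_restrict_eq_of_support_subset hu).symm
      _ ≤ eLpNorm G 2 (volume.restrict u) * volume u ^ (1 / 2 : ℝ) := by
          have := eLpNorm_le_eLpNorm_mul_rpow_measure_univ (p := 1) (q := 2)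
            (μ := volume.restrict u) (by norm_num) G.continuous.aestronglyMeasurable
          norm_num at this ⊢
          exact this
      _ = _ := by rw [mul_comm, eLpNorm_restrict_eq_of_support_subset hu]
  have h2 : ∀ t, ‖𝓕⁻ (G : ℝ → ℂ) t‖ₑ ≤ eLpNorm G 1 volume := fun t => by
    rw [Real.fourierInv_eq, eLpNorm_one_eq_lintegral_enorm]
    refine (enorm_integral_le_lintegral_enorm _).trans (le_of_eq ?_)
    refine lintegral_congr fun x => ?_
    rw [← ofReal_norm, ← ofReal_norm, Circle.norm_smul]
  have h3 := eLpNorm_le_of_ae_enorm_bound (p := 2) (μ := volume.restrict s)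
    (Filter.Eventually.of_forall h2)
  refine h3.trans ?_
  rw [smul_eq_mul, Measure.restrict_apply_univ, mul_comm]
  norm_num
  gcongr

namespace IsDyadicCutoff

variable {ψ : ℝ → ℝ}

theorem eq_zero (hψ : IsDyadicCutoff ψ) {r : ℝ} (hr : 2 ≤ |r|) : ψ r = 0 := by
  by_contra h
  exact absurd (abs_lt.2 (hψ.supp h)) (not_lt.2 hr)

theorem hasCompactSupport_div (hψ : IsDyadicCutoff ψ) {a : ℝ} (ha : 0 < a) :
    HasCompactSupport fun r => ψ (r / a) :=
  HasCompactSupport.of_support_subset_isCompact (isCompact_Icc (a := -(2 * a)) (b := 2 * a))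
    fun r hr => by
      have h := hψ.supp (show r / a ∈ Function.support ψ from hr)
      rw [Set.mem_Ioo, lt_div_iff₀ ha, div_lt_iff₀ ha] at h
      exact ⟨by linarith, h.2.le⟩

theorem contDiff_div (hψ : IsDyadicCutoff ψ) (a : ℝ) :
    ContDiff ℝ (⊤ : ℕ∞) fun r => ψ (r / a) :=
  hψ.smooth.comp (contDiff_id.div_const a)

theorem exists_bound (hψ : IsDyadicCutoff ψ) : ∃ B, 1 ≤ B ∧ ∀ r, ψ r ≤ B := by
  have hc : HasCompactSupport ψ := by simpa using hψ.hasCompactSupport_div one_pos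
  obtain ⟨C, hC⟩ := hc.exists_bound_of_continuous hψ.smooth.continuous
  have hB : ∀ r, ψ r ≤ C := fun r => (le_abs_self _).trans (hC r)
  exact ⟨C, hψ.one 0 (by norm_num) ▸ hB 0, hB⟩

end IsDyadicCutoff

theorem psiDy_zero (ψ : ℝ → ℝ) (r : ℝ) : psiDy ψ (2 ^ 0) r = ψ r := by simp [psiDy]

theorem psiDy_succ (ψ : ℝ → ℝ) (l : ℕ) (r : ℝ) :
    psiDy ψ (2 ^ (l + 1)) r = ψ (r / 2 ^ (l + 1)) - ψ (r / 2 ^ l) := by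
  have h : (2 : ℝ) ^ (l + 1) ≠ 1 := (one_lt_pow₀ one_lt_two l.succ_ne_zero).ne'
  rw [psiDy, if_neg h]
  congr 2
  field_simp
  ring

theorem sum_psiDy (ψ : ℝ → ℝ) (k : ℕ) (r : ℝ) :
    ∑ l ∈ Finset.range (k + 1), psiDy ψ (2 ^ l) r = ψ (r / 2 ^ k) := by
  induction k with
  | zero => simp [psiDy]
  | succ k ih => rw [Finset.sum_range_succ, ih, psiDy_succ]; ring

namespace IsDyadicCutoff

variable {ψ : ℝ → ℝ}

theorem exists_psiDy_mul (hψ : IsDyadicCutoff ψ) (F : SchwartzMap ℝ ℂ) (l : ℕ) :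
    ∃ G : SchwartzMap ℝ ℂ, ∀ r, G r = (psiDy ψ (2 ^ l) r : ℂ) * F r := by
  cases l with
  | zero =>
    simp_rw [psiDy_zero]
    exact SchwartzMap.exists_eq_ofReal_mul hψ.smooth
      (by simpa using hψ.hasCompactSupport_div one_pos) F
  | succ l =>
    simp_rw [psiDy_succ]
    exact SchwartzMap.exists_eq_ofReal_mul ((hψ.contDiff_div _).sub (hψ.contDiff_div _))
      ((hψ.hasCompactSupport_div (by positivity)).sub
        (hψ.hasCompactSupport_div (by positivity))) F

theorem psiDy_eq_zero (hψ : IsDyadicCutoff ψ) {l : ℕ} {r : ℝ} (hr : 2 * 2 ^ l ≤ |r|) :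
    psiDy ψ (2 ^ l) r = 0 := by
  cases l with
  | zero => rw [psiDy_zero]; exact hψ.eq_zero (by simpa using hr)
  | succ l =>
    have h : (0 : ℝ) < 2 ^ l := by positivity
    rw [psiDy_succ, hψ.eq_zero, hψ.eq_zero, sub_zero]
    · rw [abs_div, abs_of_pos h, le_div_iff₀ h]
      rw [pow_succ] at hr
      linarith
    · have h' : (0 : ℝ) < 2 ^ (l + 1) := by positivity
      rwa [abs_div, abs_of_pos h', le_div_iff₀ h']

theorem abs_psiDy_le (hψ : IsDyadicCutoff ψ) {B : ℝ} (hB1 : 1 ≤ B) (hB : ∀ r, ψ r ≤ B)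
    {l k : ℕ} (hlk : l ≤ k) (r : ℝ) : |psiDy ψ (2 ^ l) r| ≤ B * ψ (r / 2 ^ k) := by
  have hk : (0 : ℝ) < 2 ^ k := by positivity
  rcases le_or_gt |r| (2 ^ k) with h | h
  · have h1 : ψ (r / 2 ^ k) = 1 := by
      apply hψ.one
      rw [Set.mem_Icc, ← abs_le, abs_div, abs_of_pos hk, div_le_one hk]
      exact h
    rw [h1, mul_one]
    cases l with
    | zero => rw [psiDy_zero, abs_of_nonneg (hψ.nonneg _)]; exact hB _
    | succ l =>
      rw [psiDy_succ, abs_le]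
      constructor <;>
        linarith [hψ.nonneg (r / 2 ^ (l + 1)), hψ.nonneg (r / 2 ^ l), hB (r / 2 ^ (l + 1)),
          hB (r / 2 ^ l)]
  · rcases hlk.lt_or_eq with hl | rfl
    · rw [hψ.psiDy_eq_zero, abs_zero]
      · exact mul_nonneg (by linarith) (hψ.nonneg _)
      · rw [← pow_succ']
        exact (pow_le_pow_right₀ one_le_two hl).trans h.le
    · have h0 := hψ.nonneg (r / 2 ^ l)
      have h1 : psiDy ψ (2 ^ l) r = ψ (r / 2 ^ l) := by
        cases l with
        | zero => simp [psiDy]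
        | succ l =>
          have hl : (0 : ℝ) < 2 ^ l := by positivity
          rw [psiDy_succ, hψ.eq_zero (r := r / 2 ^ l), sub_zero]
          rw [abs_div, abs_of_pos hl, le_div_iff₀ hl, ← pow_succ']
          exact h.le
      rw [h1, abs_of_nonneg h0]
      exact le_mul_of_one_le_left h0 hB1

end IsDyadicCutoff

section Multiplier

variable {ψ : ℝ → ℝ} {f G : SchwartzMap ℝ ℂ}

theorem PL_eq_fourierInv {l : ℕ} (hG : ∀ r, G r = (psiDy ψ (2 ^ l) r : ℂ) * 𝓕 f r) :
    PL ψ (2 ^ l) f = 𝓕⁻ (G : ℝ → ℂ) := by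
  rw [PL, ← SchwartzMap.fourier_coe]
  congr 1
  exact funext fun r => (hG r).symm

theorem eLpNorm_PL {l : ℕ} (hG : ∀ r, G r = (psiDy ψ (2 ^ l) r : ℂ) * 𝓕 f r) :
    eLpNorm (PL ψ (2 ^ l) f) 2 volume = eLpNorm G 2 volume := by
  rw [PL_eq_fourierInv hG, G.eLpNorm_two_fourierInv]

theorem IsDyadicCutoff.sum_PL (hψ : IsDyadicCutoff ψ) {k : ℕ}
    (hG : ∀ r, G r = (ψ (r / 2 ^ k) : ℂ) * 𝓕 f r) :
    (fun t => ∑ l ∈ Finset.range (k + 1), PL ψ (2 ^ l) f t) = 𝓕⁻ (G : ℝ → ℂ) := by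
  choose H hH using fun l => hψ.exists_psiDy_mul (𝓕 f) l
  have hsum : G = ∑ l ∈ Finset.range (k + 1), H l := by
    ext r
    rw [sum_apply, hG, ← sum_psiDy ψ k r]
    simp_rw [hH]
    rw [← Finset.sum_mul]
    push_cast
    rfl
  have h : 𝓕⁻ G = ∑ l ∈ Finset.range (k + 1), 𝓕⁻ (H l) := by
    rw [hsum]
    exact map_sum (FourierTransform.fourierInvCLM ℂ (SchwartzMap ℝ ℂ)) _ _
  funext t
  rw [← SchwartzMap.fourierInv_coe, h, sum_apply]
  refine Finset.sum_congr rfl fun l _ => ?_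
  rw [PL_eq_fourierInv (hH l), SchwartzMap.fourierInv_coe]

theorem two_pow_le_iff {T : ℝ} {k : ℕ} (hk : (2 : ℝ) ^ k ≤ T⁻¹) (hk' : T⁻¹ < 2 ^ (k + 1))
    (l : ℕ) : (2 : ℝ) ^ l ≤ T⁻¹ ↔ l ∈ Finset.range (k + 1) := by
  rw [Finset.mem_range]
  constructor
  · exact fun h => (pow_lt_pow_iff_right₀ one_lt_two).1 (h.trans_lt hk')
  · exact fun h => (pow_le_pow_right₀ one_le_two (Nat.lt_succ_iff.1 h)).trans hk

theorem Pleq_eq_sum {T : ℝ} {k : ℕ} (hk : (2 : ℝ) ^ k ≤ T⁻¹) (hk' : T⁻¹ < 2 ^ (k + 1))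
    (φ : ℝ → ℂ) : Pleq ψ T φ = fun t => ∑ l ∈ Finset.range (k + 1), PL ψ (2 ^ l) φ t := by
  funext t
  simp_rw [Pleq, two_pow_le_iff hk hk']
  rw [tsum_eq_sum (s := Finset.range (k + 1)) fun l hl => if_neg hl]
  exact Finset.sum_congr rfl fun l hl => if_pos hl

theorem IsDyadicCutoff.tendsto_sum_PL (hψ : IsDyadicCutoff ψ) (f : SchwartzMap ℝ ℂ) (t : ℝ) :
    Filter.Tendsto (fun k : ℕ => ∑ l ∈ Finset.range (k + 1), PL ψ (2 ^ l) f t) Filter.atTop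
      (nhds (f t)) := by
  obtain ⟨B, hB1, hB⟩ := hψ.exists_bound
  choose G hG using fun k : ℕ => SchwartzMap.exists_eq_ofReal_mul
    (hψ.contDiff_div ((2 : ℝ) ^ k)) (hψ.hasCompactSupport_div (by positivity)) (𝓕 f)
  have h1 : ∀ k : ℕ, ∑ l ∈ Finset.range (k + 1), PL ψ (2 ^ l) f t = 𝓕⁻ (G k : ℝ → ℂ) t :=
    fun k => congrFun (hψ.sum_PL (hG k)) t
  have h2 : f t = 𝓕⁻ (𝓕 (f : ℝ → ℂ)) t := by
    rw [← SchwartzMap.fourier_coe, ← SchwartzMap.fourierInv_coe]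
    exact congrArg (fun h : SchwartzMap ℝ ℂ => h t)
      (FourierTransform.fourierInv_fourier_eq f).symm
  simp_rw [h1]
  rw [h2]
  simp_rw [Real.fourierInv_eq]
  refine tendsto_integral_of_dominated_convergence (fun r => B * ‖𝓕 f r‖) ?_ ?_ ?_ ?_
  · intro k
    exact (by fun_prop : Continuous _).aestronglyMeasurable
  · exact (𝓕 f).integrable.norm.const_mul B
  · refine fun k => Filter.Eventually.of_forall fun r => ?_
    rw [Circle.norm_smul, hG, norm_mul, Complex.norm_real, Real.norm_eq_abs,
      abs_of_nonneg (hψ.nonneg _)]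
    exact mul_le_mul_of_nonneg_right (hB _) (norm_nonneg _)
  · refine Filter.Eventually.of_forall fun r => tendsto_const_nhds.congr' ?_
    obtain ⟨n, hn⟩ := pow_unbounded_of_one_lt |r| one_lt_two
    filter_upwards [Filter.eventually_ge_atTop n] with k hk
    have hk0 : (0 : ℝ) < 2 ^ k := by positivity
    have : ψ (r / 2 ^ k) = 1 := by
      apply hψ.one
      rw [Set.mem_Icc, ← abs_le, abs_div, abs_of_pos hk0, div_le_one hk0]
      exact hn.le.trans (pow_le_pow_right₀ one_le_two hk)
    rw [hG, this, Complex.ofReal_one, one_mul, SchwartzMap.fourier_coe]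

/-- The Littlewood–Paley decomposition and the triangle inequality on an arbitrary set. -/
theorem IsDyadicCutoff.eLpNorm_restrict_le_tsum (hψ : IsDyadicCutoff ψ) (f : SchwartzMap ℝ ℂ)
    (s : Set ℝ) : eLpNorm f 2 (volume.restrict s) ≤
      ∑' l : ℕ, eLpNorm (PL ψ (2 ^ l) f) 2 (volume.restrict s) := by
  choose H hH using fun l => hψ.exists_psiDy_mul (𝓕 f) l
  have hmeas : ∀ l : ℕ, AEStronglyMeasurable (PL ψ (2 ^ l) f) (volume.restrict s) := fun l => by
    rw [PL_eq_fourierInv (hH l), ← SchwartzMap.fourierInv_coe]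
    exact (𝓕⁻ (H l)).continuous.aestronglyMeasurable
  refine (Lp.eLpNorm_lim_le_liminf_eLpNorm
    (f := fun k : ℕ => ∑ l ∈ Finset.range (k + 1), PL ψ (2 ^ l) f)
    (fun k => Finset.aestronglyMeasurable_sum _ fun l _ => hmeas l) f
    (Filter.Eventually.of_forall fun t => ?_)).trans ?_
  · simpa only [Finset.sum_apply] using hψ.tendsto_sum_PL f t
  · refine Filter.liminf_le_of_le (by isBoundedDefault) fun b hb => ?_
    obtain ⟨k, hk⟩ := hb.exists
    exact hk.trans ((eLpNorm_sum_le (fun l _ => hmeas l) one_le_two).trans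
      (ENNReal.sum_le_tsum _))

theorem IsDyadicCutoff.eLpNorm_PL_le (hψ : IsDyadicCutoff ψ) {B : ℝ} (hB1 : 1 ≤ B)
    (hB : ∀ r, ψ r ≤ B) {T : ℝ} {l k : ℕ} (hk : (2 : ℝ) ^ k ≤ T⁻¹) (hk' : T⁻¹ < 2 ^ (k + 1))
    (hl : l ≤ k) (f : SchwartzMap ℝ ℂ) :
    eLpNorm (PL ψ (2 ^ l) f) 2 volume ≤ ENNReal.ofReal B * eLpNorm (Pleq ψ T f) 2 volume := by
  obtain ⟨G, hG⟩ := SchwartzMap.exists_eq_ofReal_mul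
    (hψ.contDiff_div ((2 : ℝ) ^ k)) (hψ.hasCompactSupport_div (by positivity)) (𝓕 f)
  obtain ⟨H, hH⟩ := hψ.exists_psiDy_mul (𝓕 f) l
  rw [Pleq_eq_sum hk hk', hψ.sum_PL hG, G.eLpNorm_two_fourierInv, eLpNorm_PL hH]
  refine eLpNorm_le_mul_eLpNorm_of_ae_le_mul (Filter.Eventually.of_forall fun r => ?_) 2
  rw [hG, hH, norm_mul, norm_mul, Complex.norm_real, Complex.norm_real, Real.norm_eq_abs,
    Real.norm_eq_abs, abs_of_nonneg (hψ.nonneg _), ← mul_assoc]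
  exact mul_le_mul_of_nonneg_right (hψ.abs_psiDy_le hB1 hB hl r) (norm_nonneg _)

theorem IsDyadicCutoff.eLpNorm_Pleq_le (hψ : IsDyadicCutoff ψ) {B : ℝ}
    (hB : ∀ r, ψ r ≤ B) {T : ℝ} {k : ℕ} (hk : (2 : ℝ) ^ k ≤ T⁻¹) (hk' : T⁻¹ < 2 ^ (k + 1))
    (f : SchwartzMap ℝ ℂ) :
    eLpNorm (Pleq ψ T f) 2 volume ≤ ENNReal.ofReal B * eLpNorm f 2 volume := by
  obtain ⟨G, hG⟩ := SchwartzMap.exists_eq_ofReal_mul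
    (hψ.contDiff_div ((2 : ℝ) ^ k)) (hψ.hasCompactSupport_div (by positivity)) (𝓕 f)
  rw [Pleq_eq_sum hk hk', hψ.sum_PL hG, G.eLpNorm_two_fourierInv, ← f.eLpNorm_two_fourier,
    ← SchwartzMap.fourier_coe]
  refine eLpNorm_le_mul_eLpNorm_of_ae_le_mul (Filter.Eventually.of_forall fun r => ?_) 2
  rw [hG, norm_mul, Complex.norm_real, Real.norm_eq_abs, abs_of_nonneg (hψ.nonneg _)]
  exact mul_le_mul_of_nonneg_right (hB _) (norm_nonneg _)

theorem IsDyadicCutoff.eLpNorm_restrict_PL_le (hψ : IsDyadicCutoff ψ) {b : ℝ} (hb0 : 0 < b)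
    (hb : b ≤ 1 / 2) (f : SchwartzMap ℝ ℂ) {T : ℝ} (hT : 0 < T) (l : ℕ) :
    eLpNorm (PL ψ (2 ^ l) f) 2 (volume.restrict (Set.Icc (-(2 * T)) (2 * T))) ≤
      ENNReal.ofReal (4 * (T * 2 ^ l) ^ b) * eLpNorm (PL ψ (2 ^ l) f) 2 volume := by
  obtain ⟨H, hH⟩ := hψ.exists_psiDy_mul (𝓕 f) l
  set x : ℝ := T * 2 ^ l with hx
  have hx0 : 0 < x := by positivity
  rcases le_or_gt 1 x with h | h
  · refine (eLpNorm_mono_measure _ Measure.restrict_le_self).trans (le_mul_of_one_le_left' ?_)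
    rw [ENNReal.one_le_ofReal]
    linarith [Real.one_le_rpow h hb0.le]
  · have hsupp : Function.support H ⊆ Set.Icc (-(2 * 2 ^ l)) (2 * 2 ^ l) := fun r hr => by
      rw [Set.mem_Icc, ← abs_le]
      by_contra! hr'
      exact hr (by rw [hH, hψ.psiDy_eq_zero hr'.le]; simp)
    have hB := H.eLpNorm_two_restrict_fourierInv_le hsupp (Set.Icc (-(2 * T)) (2 * T))
    rw [eLpNorm_PL hH, PL_eq_fourierInv hH]
    refine hB.trans ?_
    rw [← mul_assoc]
    gcongr
    have hl : (0 : ℝ) < 2 ^ l := by positivity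
    rw [Real.volume_Icc, Real.volume_Icc,
      ENNReal.ofReal_rpow_of_nonneg (by linarith) (by norm_num),
      ENNReal.ofReal_rpow_of_nonneg (by linarith) (by norm_num),
      ← ENNReal.ofReal_mul (by apply Real.rpow_nonneg; linarith)]
    apply ENNReal.ofReal_le_ofReal
    rw [← Real.mul_rpow (by linarith) (by linarith),
      show (2 * T - -(2 * T)) * (2 * 2 ^ l - -(2 * 2 ^ l)) = 4 ^ (2 : ℝ) * x by
        rw [hx]; norm_num; ring,
      Real.mul_rpow (by positivity) hx0.le, ← Real.rpow_mul (by norm_num)]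
    norm_num
    simpa using Real.rpow_le_rpow_of_exponent_ge hx0 h.le hb

end Multiplier

theorem sum_two_pow_rpow_le {b : ℝ} (hb0 : 0 < b) (k : ℕ) :
    ∑ l ∈ Finset.range (k + 1), ((2 : ℝ) ^ l) ^ b ≤
      (2 : ℝ) ^ b / ((2 : ℝ) ^ b - 1) * ((2 : ℝ) ^ k) ^ b := by
  have hr : (1 : ℝ) < 2 ^ b := Real.one_lt_rpow one_lt_two hb0
  have h : ∀ l : ℕ, ((2 : ℝ) ^ l) ^ b = ((2 : ℝ) ^ b) ^ l := fun l => by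
    rw [← Real.rpow_natCast, ← Real.rpow_natCast, ← Real.rpow_mul (by norm_num),
      ← Real.rpow_mul (by norm_num), mul_comm]
  simp_rw [h]
  rw [geom_sum_eq hr.ne', div_mul_eq_mul_div, ← pow_succ']
  gcongr
  linarith

section Splitting

variable {ψ : ℝ → ℝ} {b T : ℝ}

theorem IsDyadicCutoff.Bnorm1_le_midTerm (hψ : IsDyadicCutoff ψ) {B : ℝ} (hB1 : 1 ≤ B)
    (hB : ∀ r, ψ r ≤ B) (hb0 : 0 < b) (hT : 0 < T) (hT1 : T ≤ 1) (f : SchwartzMap ℝ ℂ) :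
    Bnorm1 ψ b f ≤
      ENNReal.ofReal ((2 : ℝ) ^ b / ((2 : ℝ) ^ b - 1) * B) * midTerm ψ b T f := by
  obtain ⟨k, hk, hk'⟩ := exists_nat_pow_near (one_le_inv_iff₀.2 ⟨hT, hT1⟩) one_lt_two
  have hr : (1 : ℝ) < 2 ^ b := Real.one_lt_rpow one_lt_two hb0
  set S := (2 : ℝ) ^ b / ((2 : ℝ) ^ b - 1) with hS
  have hS1 : 1 ≤ S := by rw [hS, one_le_div (by linarith)]; linarith
  set a : ℕ → ℝ≥0∞ := fun l =>
    ENNReal.ofReal (((2 : ℝ) ^ l) ^ b) * eLpNorm (PL ψ ((2 : ℝ) ^ l) f) 2 volume with ha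
  have hsplit : Bnorm1 ψ b f = ∑ l ∈ Finset.range (k + 1), a l +
      ∑' l : ℕ, if T⁻¹ < (2 : ℝ) ^ l then a l else 0 := by
    have h1 : ∑ l ∈ Finset.range (k + 1), a l =
        ∑' l : ℕ, if (2 : ℝ) ^ l ≤ T⁻¹ then a l else 0 := by
      simp_rw [two_pow_le_iff hk hk']
      rw [tsum_eq_sum (s := Finset.range (k + 1)) fun l hl => if_neg hl]
      exact Finset.sum_congr rfl fun l hl => (if_pos hl).symm
    rw [h1, ← ENNReal.tsum_add, Bnorm1]
    refine tsum_congr fun l => ?_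
    rcases le_or_gt ((2 : ℝ) ^ l) T⁻¹ with h | h
    · rw [if_pos h, if_neg h.not_gt, add_zero]
    · rw [if_neg h.not_ge, if_pos h, zero_add]
  have hlow : ∑ l ∈ Finset.range (k + 1), a l ≤ ENNReal.ofReal (S * B) *
      (ENNReal.ofReal (T ^ (-b)) * eLpNorm (Pleq ψ T f) 2 volume) := by
    calc ∑ l ∈ Finset.range (k + 1), a l
        ≤ ∑ l ∈ Finset.range (k + 1), ENNReal.ofReal (((2 : ℝ) ^ l) ^ b) *
          (ENNReal.ofReal B * eLpNorm (Pleq ψ T f) 2 volume) := by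
          refine Finset.sum_le_sum fun l hl => ?_
          have := hψ.eLpNorm_PL_le hB1 hB hk hk' (Finset.mem_range_succ_iff.1 hl) f
          simp only [ha]
          gcongr
      _ = ENNReal.ofReal (∑ l ∈ Finset.range (k + 1), ((2 : ℝ) ^ l) ^ b) *
          (ENNReal.ofReal B * eLpNorm (Pleq ψ T f) 2 volume) := by
          rw [← Finset.sum_mul, ENNReal.ofReal_sum_of_nonneg fun l _ => by positivity]
      _ ≤ ENNReal.ofReal (S * T ^ (-b)) *
          (ENNReal.ofReal B * eLpNorm (Pleq ψ T f) 2 volume) := by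
          gcongr
          refine (sum_two_pow_rpow_le hb0 k).trans ?_
          rw [Real.rpow_neg hT.le, ← Real.inv_rpow hT.le]
          gcongr
      _ = _ := by
          rw [ENNReal.ofReal_mul (by linarith), ENNReal.ofReal_mul (by linarith)]
          ring
  rw [hsplit, midTerm, mul_add]
  refine add_le_add hlow (le_mul_of_one_le_left' ?_)
  rw [ENNReal.one_le_ofReal]
  exact one_le_mul_of_one_le_of_one_le hS1 hB1

theorem IsDyadicCutoff.midTerm_le_Bnorm1 (hψ : IsDyadicCutoff ψ) {B : ℝ} (hB1 : 1 ≤ B)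
    (hB : ∀ r, ψ r ≤ B) (hb0 : 0 < b) (hb : b ≤ 1 / 2) (hT : 0 < T) (hT1 : T ≤ 1)
    (f : SchwartzMap ℝ ℂ) (hf : Function.support f ⊆ Set.Icc (-(2 * T)) (2 * T)) :
    midTerm ψ b T f ≤ ENNReal.ofReal (4 * B + 1) * Bnorm1 ψ b f := by
  obtain ⟨k, hk, hk'⟩ := exists_nat_pow_near (one_le_inv_iff₀.2 ⟨hT, hT1⟩) one_lt_two
  have hL2 : eLpNorm f 2 volume ≤ ENNReal.ofReal (4 * T ^ b) * Bnorm1 ψ b f := by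
    rw [← eLpNorm_restrict_eq_of_support_subset hf, Bnorm1, ← ENNReal.tsum_mul_left]
    refine (hψ.eLpNorm_restrict_le_tsum f _).trans (ENNReal.tsum_le_tsum fun l => ?_)
    refine (hψ.eLpNorm_restrict_PL_le hb0 hb f hT l).trans (le_of_eq ?_)
    rw [← mul_assoc, ← ENNReal.ofReal_mul (by positivity), mul_assoc,
      ← Real.mul_rpow hT.le (by positivity)]
  have hlow : ENNReal.ofReal (T ^ (-b)) * eLpNorm (Pleq ψ T f) 2 volume ≤
      ENNReal.ofReal (4 * B) * Bnorm1 ψ b f := by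
    calc _ ≤ ENNReal.ofReal (T ^ (-b)) *
          (ENNReal.ofReal B * (ENNReal.ofReal (4 * T ^ b) * Bnorm1 ψ b f)) := by
          gcongr
          exact (hψ.eLpNorm_Pleq_le hB hk hk' f).trans (by gcongr)
      _ = _ := by
          rw [← mul_assoc, ← mul_assoc, ← ENNReal.ofReal_mul (by positivity),
            ← ENNReal.ofReal_mul (by positivity)]
          congr 2
          rw [Real.rpow_neg hT.le]
          field_simp
  rw [midTerm, ENNReal.ofReal_add (by linarith) zero_le_one, ENNReal.ofReal_one, add_mul, one_mul]
  refine add_le_add hlow (ENNReal.tsum_le_tsum fun l => ?_)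
  split_ifs
  · exact le_rfl
  · exact zero_le

end Splitting

/-- Equivalence of the Besov norm of g·ψ_T with its low/high-frequency splitting. -/
theorem besov_norm_equiv (ψ : ℝ → ℝ) (hψsmooth : ContDiff ℝ (⊤ : ℕ∞) ψ)
    (hψeven : ∀ r, ψ (-r) = ψ r) (hψnonneg : ∀ r, 0 ≤ ψ r)
    (hψsupp : Function.support ψ ⊆ Set.Ioo (-2) 2)
    (hψone : ∀ r ∈ Set.Icc (-1 : ℝ) 1, ψ r = 1)
    (b : ℝ) (hb0 : 0 < b) (hb : b ≤ 1 / 2) :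
    ∃ c C : ℝ, 0 < c ∧ 0 < C ∧
      ∀ g : SchwartzMap ℝ ℂ, ∀ T : ℝ, 0 < T → T ≤ 1 →
        ENNReal.ofReal c * Bnorm1 ψ b (fun t => g t * (ψ (t / T) : ℂ)) ≤
            midTerm ψ b T (fun t => g t * (ψ (t / T) : ℂ)) ∧
          midTerm ψ b T (fun t => g t * (ψ (t / T) : ℂ)) ≤
            ENNReal.ofReal C * Bnorm1 ψ b (fun t => g t * (ψ (t / T) : ℂ)) := by
  have hψ : IsDyadicCutoff ψ := ⟨hψsmooth, hψnonneg, hψsupp, hψone⟩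
  obtain ⟨B, hB1, hB⟩ := hψ.exists_bound
  have hr : (1 : ℝ) < 2 ^ b := Real.one_lt_rpow one_lt_two hb0
  set A := (2 : ℝ) ^ b / ((2 : ℝ) ^ b - 1) * B
  have hA : 0 < A := mul_pos (div_pos (by linarith) (by linarith)) (by linarith)
  refine ⟨A⁻¹, 4 * B + 1, inv_pos.2 hA, by linarith, fun g T hT hT1 => ?_⟩
  obtain ⟨f, hf⟩ := SchwartzMap.exists_eq_ofReal_mul (hψ.contDiff_div T)
    (hψ.hasCompactSupport_div hT) g
  have hfg : (fun t => g t * (ψ (t / T) : ℂ)) = f := by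
    funext t
    rw [hf, mul_comm]
  have hsupp : Function.support f ⊆ Set.Icc (-(2 * T)) (2 * T) := fun t ht => by
    rw [Set.mem_Icc, ← abs_le]
    by_contra! h
    refine ht ?_
    rw [hf, hψ.eq_zero, Complex.ofReal_zero, zero_mul]
    rw [abs_div, abs_of_pos hT, le_div_iff₀ hT]
    exact h.le
  rw [hfg]
  refine ⟨?_, hψ.midTerm_le_Bnorm1 hB1 hB hb0 hb hT hT1 f hsupp⟩
  rw [ENNReal.ofReal_inv_of_pos hA, ENNReal.inv_mul_le_iff (ENNReal.ofReal_pos.2 hA).ne'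
    ENNReal.ofReal_ne_top]
  exact hψ.Bnorm1_le_midTerm hB1 hB hb0 hT hT1 f
end
end

section
/- (Time-localization gain.) Let 0 < b < 1/2. There is a constant C (depending only on b and the fixed cutoff ψ) such that for all T ∈ (0,1] and all Schwartz functions g on ℝ: ‖g ψ_T‖_{B^b_{2,1}} ≤ C T^{1/2−b} ‖g‖_{B^{1/2}_{2,1}}. -/
noncomputable section

open MeasureTheory Real
open scoped FourierTransform ENNReal Classical

open scoped SchwartzMap

namespace SchwartzMap

/-- The `L²` norm of a Schwartz function. -/
def l2norm (f : 𝓢(ℝ, ℂ)) : ℝ := ‖f.toLp 2 volume‖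

lemma l2norm_nonneg (f : 𝓢(ℝ, ℂ)) : 0 ≤ l2norm f := norm_nonneg _

lemma ofReal_l2norm (f : 𝓢(ℝ, ℂ)) : ENNReal.ofReal (l2norm f) = eLpNorm f 2 volume := by
  rw [l2norm, norm_toLp, ENNReal.ofReal_toReal (f.eLpNorm_lt_top 2 volume).ne]

lemma l2norm_fourier (f : 𝓢(ℝ, ℂ)) : l2norm (𝓕 f) = l2norm f := norm_fourier_toL2_eq f

lemma l2norm_fourierInv (f : 𝓢(ℝ, ℂ)) : l2norm (𝓕⁻ f) = l2norm f := by
  rw [← l2norm_fourier, FourierTransform.fourier_fourierInv_eq]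

lemma l2norm_add_le (f g : 𝓢(ℝ, ℂ)) : l2norm (f + g) ≤ l2norm f + l2norm g := by
  have h : (f + g).toLp 2 volume = f.toLp 2 volume + g.toLp 2 volume :=
    (toLpCLM ℂ ℂ 2 (volume : Measure ℝ)).map_add f g
  rw [l2norm, h]
  exact norm_add_le _ _

lemma l2norm_le_of_forall_norm_le {f g : 𝓢(ℝ, ℂ)} {c : ℝ} (hc : 0 ≤ c)
    (h : ∀ x, ‖f x‖ ≤ c * ‖g x‖) : l2norm f ≤ c * l2norm g := by
  have h1 := eLpNorm_le_mul_eLpNorm_of_ae_le_mul (μ := volume) (Filter.Eventually.of_forall h) 2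
  rw [← ofReal_l2norm, ← ofReal_l2norm, ← ENNReal.ofReal_mul hc] at h1
  exact (ENNReal.ofReal_le_ofReal_iff (mul_nonneg hc (l2norm_nonneg g))).1 h1

/-- The pointwise product of two Schwartz functions. -/
def mulS (f g : 𝓢(ℝ, ℂ)) : 𝓢(ℝ, ℂ) := smulLeftCLM ℂ f g

@[simp] lemma mulS_apply (f g : 𝓢(ℝ, ℂ)) (x : ℝ) : mulS f g x = f x * g x := by
  simp [mulS, smulLeftCLM_apply_apply f.hasTemperateGrowth]

lemma mulS_add (f g h : 𝓢(ℝ, ℂ)) : mulS f (g + h) = mulS f g + mulS f h := map_add _ _ _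

lemma deriv_mulS (f g : 𝓢(ℝ, ℂ)) :
    derivCLM ℂ ℂ (mulS f g) = mulS (derivCLM ℂ ℂ f) g + mulS f (derivCLM ℂ ℂ g) := by
  ext x
  have h : (mulS f g : ℝ → ℂ) = fun x => f x * g x := funext (mulS_apply f g)
  simp only [derivCLM_apply, add_apply, mulS_apply, h]
  exact deriv_fun_mul f.differentiableAt g.differentiableAt

lemma l2norm_mulS_le_left {f : 𝓢(ℝ, ℂ)} {K : ℝ} (hf : ∀ x, ‖f x‖ ≤ K) (g : 𝓢(ℝ, ℂ)) :
    l2norm (mulS f g) ≤ K * l2norm g :=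
  l2norm_le_of_forall_norm_le ((norm_nonneg _).trans (hf 0)) fun x => by
    rw [mulS_apply, norm_mul]
    exact mul_le_mul_of_nonneg_right (hf x) (norm_nonneg _)

lemma l2norm_mulS_le_right (f : 𝓢(ℝ, ℂ)) {g : 𝓢(ℝ, ℂ)} {K : ℝ} (hg : ∀ x, ‖g x‖ ≤ K) :
    l2norm (mulS f g) ≤ K * l2norm f :=
  l2norm_le_of_forall_norm_le ((norm_nonneg _).trans (hg 0)) fun x => by
    rw [mulS_apply, norm_mul, mul_comm]
    exact mul_le_mul_of_nonneg_right (hg x) (norm_nonneg _)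

lemma norm_fourier_deriv (f : 𝓢(ℝ, ℂ)) (x : ℝ) :
    ‖𝓕 (derivCLM ℂ ℂ f) x‖ = 2 * π * |x| * ‖𝓕 f x‖ := by
  rw [fourier_coe]
  have h : (derivCLM ℂ ℂ f : ℝ → ℂ) = deriv f := rfl
  rw [h, Real.fourier_deriv f.integrable f.differentiable (derivCLM ℂ ℂ f).integrable]
  simp [abs_of_pos Real.pi_pos, fourier_coe]

/-- The dilation `x ↦ f (c x)` of a Schwartz function. -/
def dilate (c : ℝ) (hc : c ≠ 0) (f : 𝓢(ℝ, ℂ)) : 𝓢(ℝ, ℂ) :=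
  compCLMOfContinuousLinearEquiv ℂ (ContinuousLinearEquiv.unitsEquivAut ℝ (Units.mk0 c hc)) f

@[simp] lemma dilate_apply (c : ℝ) (hc : c ≠ 0) (f : 𝓢(ℝ, ℂ)) (x : ℝ) :
    dilate c hc f x = f (x * c) := by
  simp [dilate]

lemma deriv_dilate (c : ℝ) (hc : c ≠ 0) (f : 𝓢(ℝ, ℂ)) :
    derivCLM ℂ ℂ (dilate c hc f) = c • dilate c hc (derivCLM ℂ ℂ f) := by
  ext x
  have h : (dilate c hc f : ℝ → ℂ) = fun x => f (c * x) :=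
    funext fun x => by rw [dilate_apply, mul_comm]
  simp only [derivCLM_apply, smul_apply, dilate_apply, h]
  rw [deriv_comp_mul_left, mul_comm]

lemma l2norm_sq (f : 𝓢(ℝ, ℂ)) : l2norm f ^ 2 = ∫ x, ‖f x‖ ^ 2 := by
  have h := norm_toLp' (f := f) (p := 2) (μ := volume) (by simp) (by simp)
  rw [l2norm, h, ← Real.rpow_natCast, ← Real.rpow_mul (integral_nonneg fun _ => by positivity)]
  simp

lemma l2norm_dilate (c : ℝ) (hc : 0 < c) (f : 𝓢(ℝ, ℂ)) :
    l2norm (dilate c hc.ne' f) = c ^ (-(1 / 2) : ℝ) * l2norm f := by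
  have h : l2norm (dilate c hc.ne' f) ^ 2 = (c ^ (-(1 / 2) : ℝ) * l2norm f) ^ 2 := by
    rw [mul_pow, l2norm_sq, l2norm_sq, ← Real.rpow_natCast, ← Real.rpow_mul hc.le]
    simp only [dilate_apply]
    rw [Measure.integral_comp_mul_right (fun x => ‖f x‖ ^ 2)]
    norm_num [Real.rpow_neg_one, abs_of_pos hc]
  exact (pow_left_inj₀ (l2norm_nonneg _) (mul_nonneg (by positivity) (l2norm_nonneg _))
    two_ne_zero).1 h

lemma norm_le_of_fourier_support {f : 𝓢(ℝ, ℂ)} {R : ℝ} (hR : 0 ≤ R)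
    (hf : ∀ x, R < |x| → 𝓕 f x = 0) (x : ℝ) : ‖f x‖ ≤ (2 * R) ^ (1 / 2 : ℝ) * l2norm f := by
  have h1 : ‖f x‖ ≤ ‖(𝓕 f).toLp 1 volume‖ := by
    have := norm_fourier_apply_le_toLp_one (𝓕 f) (-x)
    have h2 : 𝓕 (𝓕 f) (-x) = 𝓕⁻ (𝓕 f) x := by
      rw [fourierInv_apply_eq]; simp
    rwa [h2, FourierTransform.fourierInv_fourier_eq] at this
  refine h1.trans ?_
  have h2 : eLpNorm (𝓕 f : 𝓢(ℝ, ℂ)) 1 volume ≤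
      eLpNorm (𝓕 f : 𝓢(ℝ, ℂ)) 2 volume * volume (Set.Icc (-R) R) ^ (1 / 2 : ℝ) := by
    have hs : Function.support (𝓕 f : 𝓢(ℝ, ℂ)) ⊆ Set.Icc (-R) R := fun y hy => by
      by_contra hc
      exact hy (hf y (by rw [Set.mem_Icc, ← abs_le] at hc; exact not_le.1 hc))
    rw [← eLpNorm_restrict_eq_of_support_subset hs]
    refine (eLpNorm_le_eLpNorm_mul_rpow_measure_univ (q := 2) (by norm_num)
      (𝓕 f : 𝓢(ℝ, ℂ)).continuous.aestronglyMeasurable).trans ?_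
    rw [Measure.restrict_apply_univ]
    norm_num
    exact mul_le_mul_left (eLpNorm_restrict_le _ _ _ _) _
  rw [norm_toLp]
  refine ENNReal.toReal_le_of_le_ofReal
    (mul_nonneg (by positivity) (l2norm_nonneg _)) (h2.trans (le_of_eq ?_))
  rw [← ofReal_l2norm, l2norm_fourier, Real.volume_Icc, ENNReal.ofReal_rpow_of_nonneg (by linarith)
    (by norm_num), ← ENNReal.ofReal_mul (l2norm_nonneg _)]
  ring_nf

end SchwartzMap

namespace SchwartzMap

/-- A sequence of multipliers adapted to the dyadic annuli `|τ| ~ 2 ^ l`, bounded by `K` and forming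
a partition of unity. -/
structure IsDyadicPartition (D : ℕ → 𝓢(ℝ, ℂ)) (K : ℝ) : Prop where
  norm_le : ∀ l x, ‖D l x‖ ≤ K
  eq_zero_of_lt : ∀ l x, |x| < 2 ^ l → D (l + 1) x = 0
  eq_zero_of_gt : ∀ l x, 2 ^ (l + 1) < |x| → D l x = 0
  sum_eq_one : ∀ n x, |x| ≤ 2 ^ n → ∑ l ∈ Finset.range (n + 1), D l x = 1
  norm_sum_sub_one_le : ∀ n x, ‖1 - ∑ l ∈ Finset.range (n + 1), D l x‖ ≤ K

/-- The `L²` norm of the `l`-th dyadic frequency piece of `f`. -/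
def pieceNorm (D : ℕ → 𝓢(ℝ, ℂ)) (l : ℕ) (f : 𝓢(ℝ, ℂ)) : ℝ := l2norm (mulS (D l) (𝓕 f))

lemma pieceNorm_nonneg (D : ℕ → 𝓢(ℝ, ℂ)) (l : ℕ) (f : 𝓢(ℝ, ℂ)) : 0 ≤ pieceNorm D l f :=
  l2norm_nonneg _

lemma pieceNorm_add_le (D : ℕ → 𝓢(ℝ, ℂ)) (l : ℕ) (f g : 𝓢(ℝ, ℂ)) :
    pieceNorm D l (f + g) ≤ pieceNorm D l f + pieceNorm D l g := by
  have h : 𝓕 (f + g) = 𝓕 f + 𝓕 g := FourierTransform.fourier_add f g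
  rw [pieceNorm, h, mulS_add]
  exact l2norm_add_le _ _

/-- The `m`-th dyadic frequency piece of `g`. -/
def piece (D : ℕ → 𝓢(ℝ, ℂ)) (m : ℕ) (g : 𝓢(ℝ, ℂ)) : 𝓢(ℝ, ℂ) := 𝓕⁻ (mulS (D m) (𝓕 g))

lemma l2norm_piece (D : ℕ → 𝓢(ℝ, ℂ)) (m : ℕ) (g : 𝓢(ℝ, ℂ)) :
    l2norm (piece D m g) = pieceNorm D m g := l2norm_fourierInv _

lemma fourier_piece (D : ℕ → 𝓢(ℝ, ℂ)) (m : ℕ) (g : 𝓢(ℝ, ℂ)) :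
    𝓕 (piece D m g) = mulS (D m) (𝓕 g) := FourierTransform.fourier_fourierInv_eq _

namespace IsDyadicPartition

variable {D : ℕ → 𝓢(ℝ, ℂ)} {K : ℝ}

lemma nonneg (hD : IsDyadicPartition D K) : 0 ≤ K := (norm_nonneg _).trans (hD.norm_le 0 0)

lemma pieceNorm_le (hD : IsDyadicPartition D K) (l : ℕ) (f : 𝓢(ℝ, ℂ)) :
    pieceNorm D l f ≤ K * l2norm f := by
  rw [← l2norm_fourier f]
  exact l2norm_mulS_le_left (hD.norm_le l) _

lemma norm_mul_fourier_le {f : 𝓢(ℝ, ℂ)} {k : ℂ} {n : ℕ} {x : ℝ} (hk : ‖k‖ ≤ K)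
    (h0 : |x| < 2 ^ n → k = 0) :
    ‖k * 𝓕 f x‖ ≤ K / 2 ^ n * ‖𝓕 (derivCLM ℂ ℂ f) x‖ := by
  have hK : 0 ≤ K := (norm_nonneg _).trans hk
  rw [norm_fourier_deriv]
  by_cases hx : |x| < 2 ^ n
  · rw [h0 hx, zero_mul, norm_zero]; positivity
  · rw [norm_mul, ← mul_assoc]
    gcongr
    have hp : (0 : ℝ) < 2 ^ n := by positivity
    rw [div_mul_eq_mul_div, le_div_iff₀ hp]
    have h1 : (1 : ℝ) ≤ 2 * π := by linarith [Real.pi_gt_three]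
    have h2 : (2 : ℝ) ^ n ≤ 2 * π * |x| := by nlinarith [not_lt.1 hx]
    exact mul_le_mul hk h2 hp.le hK

lemma pieceNorm_succ_le (hD : IsDyadicPartition D K) (l : ℕ) (f : 𝓢(ℝ, ℂ)) :
    pieceNorm D (l + 1) f ≤ K / 2 ^ l * l2norm (derivCLM ℂ ℂ f) := by
  rw [← l2norm_fourier (derivCLM ℂ ℂ f)]
  refine l2norm_le_of_forall_norm_le (div_nonneg hD.nonneg (by positivity)) fun x => ?_
  rw [mulS_apply]
  exact norm_mul_fourier_le (hD.norm_le _ x) (hD.eq_zero_of_lt l x)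

lemma l2norm_sub_sum_piece_le (hD : IsDyadicPartition D K) (n : ℕ) (g : 𝓢(ℝ, ℂ)) :
    l2norm (g - ∑ m ∈ Finset.range (n + 1), piece D m g) ≤
      K / 2 ^ n * l2norm (derivCLM ℂ ℂ g) := by
  rw [← l2norm_fourier (derivCLM ℂ ℂ g), ← l2norm_fourier]
  refine l2norm_le_of_forall_norm_le (div_nonneg hD.nonneg (by positivity)) fun x => ?_
  have h : 𝓕 (g - ∑ m ∈ Finset.range (n + 1), piece D m g) =
      𝓕 g - ∑ m ∈ Finset.range (n + 1), mulS (D m) (𝓕 g) := by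
    simp_rw [← fourier_piece]
    simp_rw [← fourierTransformCLM_apply ℂ, map_sub, map_sum]
  have h2 : (𝓕 (g - ∑ m ∈ Finset.range (n + 1), piece D m g)) x =
      (1 - ∑ m ∈ Finset.range (n + 1), D m x) * 𝓕 g x := by
    rw [h, sub_apply, sum_apply]
    simp [sub_mul, Finset.sum_mul]
  rw [h2]
  refine norm_mul_fourier_le (hD.norm_sum_sub_one_le n x) fun hx => ?_
  rw [hD.sum_eq_one n x hx.le, sub_self]

lemma norm_piece_apply_le (hD : IsDyadicPartition D K) (m : ℕ) (g : 𝓢(ℝ, ℂ)) (x : ℝ) :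
    ‖piece D m g x‖ ≤ 2 * ((2 : ℝ) ^ m) ^ (1 / 2 : ℝ) * pieceNorm D m g := by
  have h := norm_le_of_fourier_support (f := piece D m g) (R := 2 ^ (m + 1)) (by positivity)
    (fun y hy => by rw [fourier_piece, mulS_apply, hD.eq_zero_of_gt m y hy, zero_mul]) x
  rw [l2norm_piece] at h
  refine h.trans (le_of_eq ?_)
  congr 1
  rw [show (2 : ℝ) * 2 ^ (m + 1) = 2 ^ (2 : ℝ) * 2 ^ m by norm_num; ring,
    Real.mul_rpow (by positivity) (by positivity), ← Real.rpow_mul (by norm_num)]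
  norm_num

lemma l2norm_deriv_piece_le (hD : IsDyadicPartition D K) (m : ℕ) (g : 𝓢(ℝ, ℂ)) :
    l2norm (derivCLM ℂ ℂ (piece D m g)) ≤ 4 * π * 2 ^ m * pieceNorm D m g := by
  rw [← l2norm_fourier, ← l2norm_piece, ← l2norm_fourier (piece D m g)]
  refine l2norm_le_of_forall_norm_le (by positivity) fun x => ?_
  rw [norm_fourier_deriv]
  by_cases hx : 2 ^ (m + 1) < |x|
  · rw [fourier_piece, mulS_apply, hD.eq_zero_of_gt m x hx]; simp
  · refine mul_le_mul_of_nonneg_right ?_ (norm_nonneg _)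
    rw [not_lt, pow_succ] at hx
    nlinarith [Real.pi_pos]

end IsDyadicPartition

lemma tsum_le_of_geometric {a : ℕ → ℝ≥0∞} {c r : ℝ≥0∞} (n : ℕ)
    (h1 : ∀ l ≤ n, a l ≤ c * r ^ (n - l)) (h2 : ∀ l, a (l + (n + 1)) ≤ c * r ^ l) :
    ∑' l, a l ≤ c * (2 * (1 - r)⁻¹) := by
  rw [← ENNReal.summable.sum_add_tsum_nat_add' (k := n + 1), two_mul, mul_add]
  gcongr
  · calc ∑ l ∈ Finset.range (n + 1), a l
        ≤ ∑ l ∈ Finset.range (n + 1), c * r ^ (n + 1 - 1 - l) :=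
          Finset.sum_le_sum fun l hl => h1 l (by simpa [Nat.lt_succ_iff] using hl)
      _ = ∑ l ∈ Finset.range (n + 1), c * r ^ l :=
          Finset.sum_range_reflect (fun l => c * r ^ l) (n + 1)
      _ ≤ ∑' l, c * r ^ l := ENNReal.sum_le_tsum _
      _ = _ := by rw [ENNReal.tsum_mul_left, ENNReal.tsum_geometric]
  · calc ∑' l, a (l + (n + 1)) ≤ ∑' l, c * r ^ l := ENNReal.tsum_le_tsum h2
      _ = _ := by rw [ENNReal.tsum_mul_left, ENNReal.tsum_geometric]

lemma exists_tsum_interpolation_le {b : ℝ} (hb0 : 0 < b) (hb1 : b < 1) :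
    ∃ C : ℝ, 0 < C ∧ ∀ (p : ℕ → ℝ) (A N : ℝ), 0 ≤ A → 1 ≤ N → (∀ l, p l ≤ A) →
      (∀ l, p (l + 1) ≤ A * N / 2 ^ l) →
      ∑' l : ℕ, ENNReal.ofReal (((2 : ℝ) ^ l) ^ b) * ENNReal.ofReal (p l) ≤
        ENNReal.ofReal (C * A * N ^ b) := by
  set r : ℝ := max (2 ^ (-b)) (2 ^ (b - 1)) with hr
  have hr0 : 0 < r := lt_max_of_lt_left (by positivity)
  have hr1 : r < 1 := max_lt (Real.rpow_lt_one_of_one_lt_of_neg (by norm_num) (by linarith))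
    (Real.rpow_lt_one_of_one_lt_of_neg (by norm_num) (by linarith))
  refine ⟨2 * (2 * (1 - r)⁻¹), by have := sub_pos.2 hr1; positivity, ?_⟩
  intro p A N hA hN hp hp'
  obtain ⟨n, hn, hn'⟩ := exists_nat_pow_near hN (one_lt_two)
  have hN0 : 0 < N := by linarith
  have key : ∀ (l k : ℕ), ((2 : ℝ) ^ l) ^ b * p l ≤ 2 * A * N ^ b * r ^ k →
      ENNReal.ofReal (((2 : ℝ) ^ l) ^ b) * ENNReal.ofReal (p l) ≤
        ENNReal.ofReal (2 * A * N ^ b) * ENNReal.ofReal r ^ k := fun l k h => by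
    rw [← ENNReal.ofReal_mul (by positivity), ← ENNReal.ofReal_pow hr0.le,
      ← ENNReal.ofReal_mul (by positivity)]
    exact ENNReal.ofReal_le_ofReal h
  have h := tsum_le_of_geometric
    (a := fun l : ℕ => ENNReal.ofReal (((2 : ℝ) ^ l) ^ b) * ENNReal.ofReal (p l))
    (c := ENNReal.ofReal (2 * A * N ^ b)) (r := ENNReal.ofReal r) n
    (fun l hl => key l _ ?_) (fun l => key _ _ ?_)
  · refine h.trans (le_of_eq ?_)
    rw [← ENNReal.ofReal_one, ← ENNReal.ofReal_sub _ hr0.le,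
      ← ENNReal.ofReal_inv_of_pos (sub_pos.2 hr1),
      show (2 : ℝ≥0∞) = ENNReal.ofReal 2 by simp, ← ENNReal.ofReal_mul (by norm_num),
      ← ENNReal.ofReal_mul (by positivity)]
    congr 1; ring
  · obtain ⟨k, rfl⟩ := Nat.exists_eq_add_of_le hl
    rw [Nat.add_sub_cancel_left]
    have e1 : ((2 : ℝ) ^ l) ^ b = ((2 : ℝ) ^ (l + k)) ^ b * ((2 : ℝ) ^ (-b)) ^ k := by
      simp only [← Real.rpow_natCast, ← Real.rpow_mul (zero_le_two (α := ℝ)),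
        ← Real.rpow_add (zero_lt_two (α := ℝ))]
      congr 1; push_cast; ring
    have e2 : ((2 : ℝ) ^ (l + k)) ^ b ≤ N ^ b := Real.rpow_le_rpow (by positivity) hn hb0.le
    have e3 : ((2 : ℝ) ^ (-b)) ^ k ≤ r ^ k :=
      pow_le_pow_left₀ (by positivity) (le_max_left _ _) k
    calc ((2 : ℝ) ^ l) ^ b * p l ≤ (N ^ b * r ^ k) * A := by
          rw [e1]
          exact mul_le_mul_of_nonneg_left (hp l) (by positivity) |>.trans
            (mul_le_mul_of_nonneg_right (mul_le_mul e2 e3 (by positivity) (by positivity)) hA)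
      _ ≤ 2 * A * N ^ b * r ^ k := by
          have : 0 ≤ N ^ b * r ^ k * A := by positivity
          nlinarith
  · have e1 : ((2 : ℝ) ^ (l + (n + 1))) ^ b * (A * N / 2 ^ (l + n)) =
        2 * A * N * (((2 : ℝ) ^ (n + 1)) ^ (b - 1) * ((2 : ℝ) ^ (b - 1)) ^ l) := by
      have h2 : (2 : ℝ) ^ (l + (n + 1)) = 2 * 2 ^ (l + n) := by ring
      have h3 : ((2 : ℝ) ^ (l + (n + 1))) ^ b =
          2 ^ (l + (n + 1)) * ((2 : ℝ) ^ (l + (n + 1))) ^ (b - 1) := by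
        rw [Real.rpow_sub_one (by positivity)]; field_simp
      have h4 : ((2 : ℝ) ^ (l + (n + 1))) ^ (b - 1) =
          ((2 : ℝ) ^ (n + 1)) ^ (b - 1) * ((2 : ℝ) ^ (b - 1)) ^ l := by
        simp only [← Real.rpow_natCast, ← Real.rpow_mul (zero_le_two (α := ℝ)),
          ← Real.rpow_add (zero_lt_two (α := ℝ))]
        congr 1; push_cast; ring
      rw [h3, h4, h2]; field_simp
    have e2 : ((2 : ℝ) ^ (n + 1)) ^ (b - 1) ≤ N ^ (b - 1) :=
      Real.rpow_le_rpow_of_nonpos hN0 hn'.le (by linarith)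
    have e3 : ((2 : ℝ) ^ (b - 1)) ^ l ≤ r ^ l :=
      pow_le_pow_left₀ (by positivity) (le_max_right _ _) l
    have e4 : N * N ^ (b - 1) = N ^ b := by
      rw [Real.rpow_sub_one hN0.ne']; field_simp
    calc ((2 : ℝ) ^ (l + (n + 1))) ^ b * p (l + (n + 1))
        ≤ ((2 : ℝ) ^ (l + (n + 1))) ^ b * (A * N / 2 ^ (l + n)) :=
          mul_le_mul_of_nonneg_left (hp' (l + n)) (by positivity)
      _ ≤ 2 * A * N * (N ^ (b - 1) * r ^ l) := by
          rw [e1]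
          exact mul_le_mul_of_nonneg_left (mul_le_mul e2 e3 (by positivity) (by positivity))
            (by positivity)
      _ = 2 * A * N ^ b * r ^ l := by rw [← e4]; ring

end SchwartzMap

namespace SchwartzMap

lemma l2norm_smul (c : ℝ) (f : 𝓢(ℝ, ℂ)) : l2norm (c • f) = |c| * l2norm f := by
  have h : (c • f).toLp 2 volume = c • f.toLp 2 volume :=
    (toLpCLM ℝ ℂ 2 (volume : Measure ℝ)).map_smul c f
  rw [l2norm, h, norm_smul, Real.norm_eq_abs, l2norm]

lemma exists_norm_le (f : 𝓢(ℝ, ℂ)) : ∃ K : ℝ, 0 ≤ K ∧ ∀ x, ‖f x‖ ≤ K :=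
  ⟨_, apply_nonneg _ _, fun x => norm_le_seminorm ℝ f x⟩

namespace IsDyadicPartition

variable {D : ℕ → 𝓢(ℝ, ℂ)} {K : ℝ}

lemma exists_localization_bounds (hD : IsDyadicPartition D K) (P : 𝓢(ℝ, ℂ)) {b : ℝ}
    (hb : b < 1 / 2) : ∃ κ : ℝ, 0 < κ ∧ ∀ (T : ℝ) (hT : 0 < T), T ≤ 1 → ∀ (g : 𝓢(ℝ, ℂ)) (m : ℕ),
      ∃ A N : ℝ, 0 ≤ A ∧ 1 ≤ N ∧
        l2norm (mulS (dilate T⁻¹ (inv_ne_zero hT.ne') P) (piece D m g)) ≤ A ∧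
        l2norm (derivCLM ℂ ℂ (mulS (dilate T⁻¹ (inv_ne_zero hT.ne') P) (piece D m g))) ≤ A * N ∧
        A * N ^ b ≤ κ * T ^ (1 / 2 - b) * (((2 : ℝ) ^ m) ^ (1 / 2 : ℝ) * pieceNorm D m g) := by
  obtain ⟨K₀, hK₀, hP⟩ := exists_norm_le P
  obtain ⟨K₁, hK₁, hP'⟩ := exists_norm_le (derivCLM ℂ ℂ P)
  set a₀ := l2norm P with ha₀
  set a₁ := l2norm (derivCLM ℂ ℂ P) with ha₁
  have ha₀' : 0 ≤ a₀ := l2norm_nonneg _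
  have ha₁' : 0 ≤ a₁ := l2norm_nonneg _
  have hπ := Real.pi_pos
  have hKπ : 0 ≤ 4 * π * K₀ := by positivity
  refine ⟨2 * a₀ + 2 * a₁ + K₀ + K₁ + 4 * π * K₀ + 1, by positivity, ?_⟩
  set κ := 2 * a₀ + 2 * a₁ + K₀ + K₁ + 4 * π * K₀ + 1 with hκ
  have hκ0 : 0 < κ := by positivity
  intro T hT hT1 g m
  set φ := dilate T⁻¹ (inv_ne_zero hT.ne') P with hφ
  set h := piece D m g with hh
  set M : ℝ := 2 ^ m with hM
  set q := pieceNorm D m g with hq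
  have hq0 : 0 ≤ q := pieceNorm_nonneg _ _ _
  have hM1 : 1 ≤ M := one_le_pow₀ (by norm_num)
  have hM0 : 0 < M := by linarith
  have hhq : l2norm h = q := l2norm_piece _ _ _
  have hh' : l2norm (derivCLM ℂ ℂ h) ≤ 4 * π * M * q := hD.l2norm_deriv_piece_le m g
  have hφK : ∀ x, ‖φ x‖ ≤ K₀ := fun x => by rw [hφ, dilate_apply]; exact hP _
  have hφ' : derivCLM ℂ ℂ φ = T⁻¹ • dilate T⁻¹ (inv_ne_zero hT.ne') (derivCLM ℂ ℂ P) :=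
    deriv_dilate _ _ _
  have hφK' : ∀ x, ‖derivCLM ℂ ℂ φ x‖ ≤ T⁻¹ * K₁ := fun x => by
    rw [hφ', smul_apply, dilate_apply, norm_smul, Real.norm_of_nonneg (by positivity)]
    exact mul_le_mul_of_nonneg_left (hP' _) (by positivity)
  have hd : l2norm (derivCLM ℂ ℂ (mulS φ h)) ≤
      l2norm (mulS (derivCLM ℂ ℂ φ) h) + l2norm (mulS φ (derivCLM ℂ ℂ h)) := by
    rw [deriv_mulS]; exact l2norm_add_le _ _
  have hd2 : l2norm (mulS φ (derivCLM ℂ ℂ h)) ≤ K₀ * (4 * π * M * q) :=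
    (l2norm_mulS_le_left hφK _).trans (mul_le_mul_of_nonneg_left hh' hK₀)
  rcases le_total (T * M) 1 with hTM | hTM
  · set t := T ^ (1 / 2 : ℝ) with ht
    set s := M ^ (1 / 2 : ℝ) with hs
    have ht0 : 0 < t := by positivity
    have hs0 : 0 < s := by positivity
    have hts : t * s ≤ 1 := by
      rw [ht, hs, ← Real.mul_rpow hT.le hM0.le]
      exact Real.rpow_le_one (by positivity) hTM (by norm_num)
    have htt : T = t * t := by rw [ht, ← Real.rpow_add hT]; norm_num
    have hss : M = s * s := by rw [hs, ← Real.rpow_add hM0]; norm_num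
    have hTt : (T⁻¹) ^ (-(1 / 2) : ℝ) = t := by
      rw [Real.inv_rpow hT.le, Real.rpow_neg hT.le, inv_inv]
    have hsup : ∀ x, ‖h x‖ ≤ 2 * s * q := hD.norm_piece_apply_le m g
    have hn0 : l2norm φ = t * a₀ := by
      rw [hφ, l2norm_dilate _ (inv_pos.2 hT), hTt]
    have hn1 : l2norm (derivCLM ℂ ℂ φ) = T⁻¹ * (t * a₁) := by
      rw [hφ', l2norm_smul, l2norm_dilate _ (inv_pos.2 hT), hTt, abs_of_pos (inv_pos.2 hT)]
    refine ⟨κ * (t * s * q), T⁻¹, by positivity, (one_le_inv₀ hT).2 hT1, ?_, ?_, ?_⟩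
    · have := l2norm_mulS_le_right φ hsup
      rw [hn0] at this
      calc _ ≤ 2 * s * q * (t * a₀) := this
        _ = (2 * a₀) * (t * s * q) := by ring
        _ ≤ κ * (t * s * q) := mul_le_mul_of_nonneg_right (by linarith) (by positivity)
    · have h1 := l2norm_mulS_le_right (derivCLM ℂ ℂ φ) hsup
      rw [hn1] at h1
      have h2 : M ≤ t * s * T⁻¹ := by
        rw [← div_eq_mul_inv, le_div_iff₀ hT, htt, hss]
        calc s * s * (t * t) = (t * s) * (t * s) := by ring
          _ ≤ (t * s) * 1 := mul_le_mul_of_nonneg_left hts (by positivity)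
          _ = t * s := mul_one _
      have h3 : K₀ * (4 * π * M * q) ≤ 4 * π * K₀ * (t * s * T⁻¹ * q) := by
        calc K₀ * (4 * π * M * q) = 4 * π * K₀ * (M * q) := by ring
          _ ≤ _ := by gcongr
      calc _ ≤ 2 * s * q * (T⁻¹ * (t * a₁)) + 4 * π * K₀ * (t * s * T⁻¹ * q) := by linarith
        _ = (2 * a₁ + 4 * π * K₀) * (t * s * T⁻¹ * q) := by ring
        _ ≤ κ * (t * s * T⁻¹ * q) := mul_le_mul_of_nonneg_right (by linarith) (by positivity)
        _ = _ := by ring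
    · rw [Real.rpow_sub hT, ← ht, Real.inv_rpow hT.le]
      exact le_of_eq (by field_simp)
  · refine ⟨κ * q, M, by positivity, hM1, ?_, ?_, ?_⟩
    · have := l2norm_mulS_le_left hφK h
      rw [hhq] at this
      exact this.trans (mul_le_mul_of_nonneg_right (by linarith) hq0)
    · have h1 := l2norm_mulS_le_left hφK' h
      rw [hhq] at h1
      have h2 : T⁻¹ ≤ M := by rwa [inv_le_iff_one_le_mul₀' hT]
      have h3 : T⁻¹ * K₁ * q ≤ M * K₁ * q := by gcongr
      calc _ ≤ M * K₁ * q + K₀ * (4 * π * M * q) := by linarith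
        _ = (K₁ + 4 * π * K₀) * (q * M) := by ring
        _ ≤ κ * (q * M) := mul_le_mul_of_nonneg_right (by linarith) (by positivity)
        _ = _ := by ring
    · have h1 : M ^ b ≤ T ^ (1 / 2 - b) * M ^ (1 / 2 : ℝ) := by
        have h2 : M ^ b = M ^ (1 / 2 : ℝ) / M ^ (1 / 2 - b) := by
          rw [← Real.rpow_sub hM0]; congr 1; ring
        rw [h2, div_le_iff₀ (by positivity), mul_right_comm, ← Real.mul_rpow hT.le hM0.le]
        exact le_mul_of_one_le_left (by positivity) (Real.one_le_rpow hTM (by linarith))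
      calc κ * q * M ^ b ≤ κ * q * (T ^ (1 / 2 - b) * M ^ (1 / 2 : ℝ)) := by gcongr
        _ = _ := by ring

lemma pieceNorm_mulS_le_tsum (hD : IsDyadicPartition D K) (φ g : 𝓢(ℝ, ℂ)) (l : ℕ) :
    ENNReal.ofReal (pieceNorm D l (mulS φ g)) ≤
      ∑' m, ENNReal.ofReal (pieceNorm D l (mulS φ (piece D m g))) := by
  obtain ⟨K₀, hK₀, hφ⟩ := exists_norm_le φ
  have hsum : ∀ s : Finset ℕ, pieceNorm D l (mulS φ (∑ m ∈ s, piece D m g)) ≤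
      ∑ m ∈ s, pieceNorm D l (mulS φ (piece D m g)) := fun s => by
    induction s using Finset.induction_on with
    | empty =>
      refine (hD.pieceNorm_le _ _).trans ?_
      have := l2norm_mulS_le_left hφ (0 : 𝓢(ℝ, ℂ))
      have h0 : l2norm (0 : 𝓢(ℝ, ℂ)) = 0 := by simpa using l2norm_smul 0 (0 : 𝓢(ℝ, ℂ))
      rw [h0, mul_zero] at this
      simpa using mul_nonpos_of_nonneg_of_nonpos hD.nonneg this
    | insert m s hm ih =>
      rw [Finset.sum_insert hm, Finset.sum_insert hm, mulS_add]
      exact (pieceNorm_add_le _ _ _ _).trans (add_le_add_right ih _)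
  set B := K * (K₀ * (K * l2norm (derivCLM ℂ ℂ g))) with hB
  have hfin : ∀ n : ℕ, ENNReal.ofReal (pieceNorm D l (mulS φ g)) ≤
      ∑' m, ENNReal.ofReal (pieceNorm D l (mulS φ (piece D m g))) +
        ENNReal.ofReal (B * (1 / 2) ^ n) := fun n => by
    have h1 : pieceNorm D l (mulS φ g) ≤
        ∑ m ∈ Finset.range (n + 1), pieceNorm D l (mulS φ (piece D m g)) + B * (1 / 2) ^ n := by
      set S := ∑ m ∈ Finset.range (n + 1), piece D m g with hS
      have h2 : mulS φ g = mulS φ S + mulS φ (g - S) := by rw [← mulS_add]; congr 1; abel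
      rw [h2]
      refine (pieceNorm_add_le _ _ _ _).trans (add_le_add (hsum _) ?_)
      calc _ ≤ K * (K₀ * (K / 2 ^ n * l2norm (derivCLM ℂ ℂ g))) :=
            (hD.pieceNorm_le _ _).trans (mul_le_mul_of_nonneg_left
              ((l2norm_mulS_le_left hφ _).trans (mul_le_mul_of_nonneg_left
                (hD.l2norm_sub_sum_piece_le n g) hK₀)) hD.nonneg)
        _ = _ := by rw [hB, one_div, inv_pow]; ring
    refine (ENNReal.ofReal_le_ofReal h1).trans (ENNReal.ofReal_add_le.trans ?_)
    rw [ENNReal.ofReal_sum_of_nonneg fun _ _ => pieceNorm_nonneg _ _ _]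
    gcongr
    exact ENNReal.sum_le_tsum _
  have hlim : Filter.Tendsto (fun n : ℕ => ENNReal.ofReal (B * (1 / 2) ^ n)) Filter.atTop
      (nhds 0) := by
    have h := (tendsto_pow_atTop_nhds_zero_of_lt_one (r := (1 / 2 : ℝ)) (by norm_num)
      (by norm_num)).const_mul B
    simpa using ENNReal.tendsto_ofReal h
  refine ge_of_tendsto' (x := Filter.atTop) ?_ hfin
  simpa using hlim.const_add
    (∑' m, ENNReal.ofReal (pieceNorm D l (mulS φ (piece D m g))))

lemma exists_time_localization_le (hD : IsDyadicPartition D K) (P : 𝓢(ℝ, ℂ)) {b : ℝ}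
    (hb0 : 0 < b) (hb : b < 1 / 2) :
    ∃ C : ℝ, 0 < C ∧ ∀ (T : ℝ) (hT : 0 < T), T ≤ 1 → ∀ g : 𝓢(ℝ, ℂ),
      ∑' l : ℕ, ENNReal.ofReal (((2 : ℝ) ^ l) ^ b) *
        ENNReal.ofReal (pieceNorm D l (mulS (dilate T⁻¹ (inv_ne_zero hT.ne') P) g)) ≤
      ENNReal.ofReal (C * T ^ (1 / 2 - b)) * ∑' m : ℕ,
        ENNReal.ofReal (((2 : ℝ) ^ m) ^ (1 / 2 : ℝ)) * ENNReal.ofReal (pieceNorm D m g) := by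
  obtain ⟨κ, hκ, H⟩ := hD.exists_localization_bounds P hb
  obtain ⟨C, hC, I⟩ := exists_tsum_interpolation_le hb0 (by linarith)
  have hK := hD.nonneg
  refine ⟨C * (K + 1) * κ, by positivity, fun T hT hT1 g => ?_⟩
  set φ := dilate T⁻¹ (inv_ne_zero hT.ne') P with hφ
  calc _ ≤ ∑' l : ℕ, ENNReal.ofReal (((2 : ℝ) ^ l) ^ b) *
        ∑' m, ENNReal.ofReal (pieceNorm D l (mulS φ (piece D m g))) :=
        ENNReal.tsum_le_tsum fun l => mul_le_mul_right (hD.pieceNorm_mulS_le_tsum φ g l) _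
    _ = ∑' m : ℕ, ∑' l : ℕ, ENNReal.ofReal (((2 : ℝ) ^ l) ^ b) *
        ENNReal.ofReal (pieceNorm D l (mulS φ (piece D m g))) := by
        simp_rw [← ENNReal.tsum_mul_left]; exact ENNReal.tsum_comm
    _ ≤ ∑' m : ℕ, ENNReal.ofReal (C * (K + 1) * κ * T ^ (1 / 2 - b)) *
        (ENNReal.ofReal (((2 : ℝ) ^ m) ^ (1 / 2 : ℝ)) * ENNReal.ofReal (pieceNorm D m g)) := by
        refine ENNReal.tsum_le_tsum fun m => ?_
        obtain ⟨A, N, hA, hN, h1, h2, h3⟩ := H T hT hT1 g m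
        refine (I (fun l => pieceNorm D l (mulS φ (piece D m g))) ((K + 1) * A) N (by positivity)
          hN (fun l => ?_) (fun l => ?_)).trans ?_
        · exact (hD.pieceNorm_le _ _).trans (mul_le_mul (by linarith) h1 (l2norm_nonneg _)
            (by linarith))
        · refine (hD.pieceNorm_succ_le _ _).trans ?_
          calc _ ≤ (K + 1) / 2 ^ l * (A * N) :=
                mul_le_mul (by gcongr; linarith) h2 (l2norm_nonneg _) (by positivity)
            _ = _ := by ring
        · rw [← ENNReal.ofReal_mul (by positivity), ← ENNReal.ofReal_mul (by positivity)]
          refine ENNReal.ofReal_le_ofReal ?_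
          calc C * ((K + 1) * A) * N ^ b = C * (K + 1) * (A * N ^ b) := by ring
            _ ≤ C * (K + 1) * (κ * T ^ (1 / 2 - b) *
                (((2 : ℝ) ^ m) ^ (1 / 2 : ℝ) * pieceNorm D m g)) := by gcongr
            _ = _ := by ring
    _ = _ := ENNReal.tsum_mul_left

end IsDyadicPartition

end SchwartzMap

/-- The dyadic bump `ψ_L`, `L = 2 ^ l`, built from a Schwartz cutoff. -/
def dyadicBump (P : 𝓢(ℝ, ℂ)) : ℕ → 𝓢(ℝ, ℂ)
  | 0 => P
  | l + 1 => P.dilate ((2 ^ (l + 1))⁻¹) (by positivity) - P.dilate ((2 ^ l)⁻¹) (by positivity)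

lemma sum_dyadicBump (P : 𝓢(ℝ, ℂ)) (n : ℕ) (x : ℝ) :
    ∑ l ∈ Finset.range (n + 1), dyadicBump P l x = P (x * (2 ^ n)⁻¹) := by
  induction n with
  | zero => simp [dyadicBump]
  | succ n ih => rw [Finset.sum_range_succ, ih]; simp [dyadicBump]

lemma dyadicBump_apply {ψ : ℝ → ℝ} {P : 𝓢(ℝ, ℂ)} (hP : ∀ x, P x = ψ x) (l : ℕ) (x : ℝ) :
    dyadicBump P l x = psiDy ψ (2 ^ l) x := by
  cases l with
  | zero => simp [dyadicBump, psiDy, hP]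
  | succ l =>
    have h : (2 : ℝ) ^ (l + 1) ≠ 1 := (one_lt_pow₀ (by norm_num) (by simp)).ne'
    have h2 : 2 * x / 2 ^ (l + 1) = x / 2 ^ l := by rw [pow_succ]; field_simp
    simp only [dyadicBump, psiDy, if_neg h, sub_apply, SchwartzMap.dilate_apply, hP,
      h2, ← div_eq_mul_inv]
    push_cast; rfl

lemma exists_isDyadicPartition_dyadicBump {ψ : ℝ → ℝ} {P : 𝓢(ℝ, ℂ)} (hP : ∀ x, P x = ψ x)
    (hψsupp : Function.support ψ ⊆ Set.Ioo (-2) 2) (hψone : ∀ r ∈ Set.Icc (-1 : ℝ) 1, ψ r = 1) :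
    ∃ K, SchwartzMap.IsDyadicPartition (dyadicBump P) K := by
  obtain ⟨K, hK, hPK⟩ := P.exists_norm_le
  have hone : ∀ (n : ℕ) (x : ℝ), |x| ≤ 2 ^ n → P (x * (2 ^ n)⁻¹) = 1 := fun n x hx => by
    rw [hP, hψone _ (abs_le.1 _), Complex.ofReal_one]
    rw [abs_mul, abs_inv, abs_of_pos (by positivity : (0 : ℝ) < 2 ^ n), ← div_eq_mul_inv]
    exact div_le_one_of_le₀ hx (by positivity)
  have hzero : ∀ (n : ℕ) (x : ℝ), 2 ^ (n + 1) < |x| → P (x * (2 ^ n)⁻¹) = 0 := fun n x hx => by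
    rw [hP, Complex.ofReal_eq_zero]
    by_contra hc
    have h := abs_lt.2 (hψsupp hc)
    rw [abs_mul, abs_inv, abs_of_pos (by positivity : (0 : ℝ) < 2 ^ n), ← div_eq_mul_inv,
      div_lt_iff₀ (by positivity)] at h
    rw [pow_succ] at hx
    linarith
  refine ⟨1 + 2 * K, ⟨fun l x => ?_, fun l x hx => ?_, fun l x hx => ?_, fun n x hx => ?_,
    fun n x => ?_⟩⟩
  · cases l with
    | zero => exact (hPK x).trans (by linarith)
    | succ l =>
      simp only [dyadicBump, sub_apply, SchwartzMap.dilate_apply]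
      exact (norm_sub_le _ _).trans ((add_le_add (hPK _) (hPK _)).trans (by linarith))
  · simp only [dyadicBump, sub_apply, SchwartzMap.dilate_apply]
    rw [hone l x hx.le, hone (l + 1) x (hx.le.trans (by gcongr <;> simp)), sub_self]
  · cases l with
    | zero => simpa [dyadicBump] using hzero 0 x hx
    | succ l =>
      simp only [dyadicBump, sub_apply, SchwartzMap.dilate_apply]
      rw [hzero _ x hx, hzero l x (lt_of_le_of_lt (by gcongr <;> simp) hx), sub_self]
  · rw [sum_dyadicBump, hone n x hx]
  · rw [sum_dyadicBump]
    exact (norm_sub_le _ _).trans (by rw [norm_one]; linarith [hPK (x * (2 ^ n)⁻¹)])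

lemma Bnorm1_eq_tsum_pieceNorm {ψ : ℝ → ℝ} {P : 𝓢(ℝ, ℂ)} (hP : ∀ x, P x = ψ x) (b : ℝ)
    (f : 𝓢(ℝ, ℂ)) :
    Bnorm1 ψ b f = ∑' l : ℕ, ENNReal.ofReal (((2 : ℝ) ^ l) ^ b) *
      ENNReal.ofReal (SchwartzMap.pieceNorm (dyadicBump P) l f) := by
  refine tsum_congr fun l => ?_
  congr 1
  have h : PL ψ (2 ^ l) f = SchwartzMap.piece (dyadicBump P) l f := by
    rw [SchwartzMap.piece, SchwartzMap.fourierInv_coe, PL]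
    congr 1
    ext x
    rw [SchwartzMap.mulS_apply, dyadicBump_apply hP, SchwartzMap.fourier_coe]
  rw [h, ← SchwartzMap.ofReal_l2norm, SchwartzMap.l2norm_piece]

/-- Time-localization gain: ‖g ψ_T‖_{B^b_{2,1}} ≲ T^{1/2−b} ‖g‖_{B^{1/2}_{2,1}}. -/
theorem besov_time_localization_gain (ψ : ℝ → ℝ) (hψsmooth : ContDiff ℝ (⊤ : ℕ∞) ψ)
    (hψeven : ∀ r, ψ (-r) = ψ r) (hψnonneg : ∀ r, 0 ≤ ψ r)
    (hψsupp : Function.support ψ ⊆ Set.Ioo (-2) 2)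
    (hψone : ∀ r ∈ Set.Icc (-1 : ℝ) 1, ψ r = 1)
    (b : ℝ) (hb0 : 0 < b) (hb : b < 1 / 2) :
    ∃ C : ℝ, 0 < C ∧
      ∀ T : ℝ, 0 < T → T ≤ 1 → ∀ g : SchwartzMap ℝ ℂ,
        Bnorm1 ψ b (fun t => g t * (ψ (t / T) : ℂ)) ≤
          ENNReal.ofReal (C * T ^ (1 / 2 - b)) * Bnorm1 ψ (1 / 2) ⇑g := by
  have hcs : HasCompactSupport fun x => (ψ x : ℂ) :=
    HasCompactSupport.intro (isCompact_Icc (a := (-2 : ℝ)) (b := 2)) fun x hx => by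
      by_contra hc
      exact hx (Set.Ioo_subset_Icc_self (hψsupp fun h => hc (by rw [h, Complex.ofReal_zero])))
  let P := hcs.toSchwartzMap (Complex.ofRealCLM.contDiff.comp hψsmooth)
  have hP : ∀ x, P x = ψ x := fun _ => rfl
  obtain ⟨K, hD⟩ := exists_isDyadicPartition_dyadicBump hP hψsupp hψone
  obtain ⟨C, hC, H⟩ := hD.exists_time_localization_le P hb0 hb
  refine ⟨C, hC, fun T hT hT1 g => ?_⟩
  have h : (fun t => g t * (ψ (t / T) : ℂ)) =
      SchwartzMap.mulS (P.dilate T⁻¹ (inv_ne_zero hT.ne')) g := by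
    ext t
    rw [SchwartzMap.mulS_apply, SchwartzMap.dilate_apply, hP, mul_comm, div_eq_mul_inv]
  rw [h, Bnorm1_eq_tsum_pieceNorm hP, Bnorm1_eq_tsum_pieceNorm hP]
  exact H T hT hT1 g
end
end

section
/- (Localized Duhamel estimate in Besov spaces.) Let 𝓘(g)(t) = ∫₀ᵗ g(t') dt'. There is a constant C (depending only on the fixed cutoff ψ) such that for all T ∈ (0,1] and all Schwartz functions g on ℝ: ‖ψ_T · 𝓘(g)‖_{B^{1/2}_{2,1}} ≤ C T^{1/12} ‖g‖_{B^{−5/12}_{2,∞}}. -/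
noncomputable section

open MeasureTheory Real
open scoped FourierTransform ENNReal Classical

open scoped SchwartzMap

section L2

/-- The `L²` norm of a Schwartz function on the line. -/
def l2Norm (f : 𝓢(ℝ, ℂ)) : ℝ := ‖f.toLp 2‖

lemma l2Norm_nonneg (f : 𝓢(ℝ, ℂ)) : 0 ≤ l2Norm f := norm_nonneg _

lemma l2Norm_fourier (f : 𝓢(ℝ, ℂ)) : l2Norm (𝓕 f) = l2Norm f :=
  SchwartzMap.norm_fourier_toL2_eq f

lemma schwartz_eLpNorm_eq (f : 𝓢(ℝ, ℂ)) :
    eLpNorm f 2 volume = ENNReal.ofReal (l2Norm f) := by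
  rw [l2Norm, SchwartzMap.norm_toLp, ENNReal.ofReal_toReal (f.eLpNorm_lt_top 2 volume).ne]

lemma l2Norm_le_mul {f g : 𝓢(ℝ, ℂ)} {c : ℝ} (h : ∀ x, ‖f x‖ ≤ c * ‖g x‖) :
    l2Norm f ≤ c * l2Norm g := by
  apply Lp.norm_le_mul_norm_of_ae_le_mul
  filter_upwards [f.coeFn_toLp 2, g.coeFn_toLp 2] with x hf hg
  rw [hf, hg]
  exact h x

lemma l2Norm_le_add {f g h : 𝓢(ℝ, ℂ)} {c d : ℝ} (hc : 0 ≤ c) (hd : 0 ≤ d)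
    (H : ∀ x, ‖f x‖ ≤ c * ‖g x‖ + d * ‖h x‖) :
    l2Norm f ≤ c * l2Norm g + d * l2Norm h := by
  have hg := mul_nonneg hc (l2Norm_nonneg g)
  have hh := mul_nonneg hd (l2Norm_nonneg h)
  have h1 : eLpNorm f 2 volume ≤
      eLpNorm ((fun x => c * ‖g x‖) + (fun x => d * ‖h x‖)) 2 volume := by
    apply eLpNorm_mono_real
    exact H
  have h2 : ∀ (c : ℝ), 0 ≤ c → ∀ g : 𝓢(ℝ, ℂ), eLpNorm (fun x => c * ‖g x‖) 2 volume ≤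
      ENNReal.ofReal (c * l2Norm g) := by
    intro c hc g
    rw [ENNReal.ofReal_mul hc, ← schwartz_eLpNorm_eq]
    refine eLpNorm_le_mul_eLpNorm_of_ae_le_mul (ae_of_all _ fun x => ?_) 2
    simp [abs_of_nonneg hc]
  have h3 := eLpNorm_add_le (μ := volume) (p := 2)
    (f := fun x => c * ‖g x‖) (g := fun x => d * ‖h x‖)
    (by fun_prop) (by fun_prop) (by norm_num)
  rw [schwartz_eLpNorm_eq] at h1
  have h4 := h1.trans (h3.trans (add_le_add (h2 c hc g) (h2 d hd h)))
  rwa [← ENNReal.ofReal_add hg hh,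
    ENNReal.ofReal_le_ofReal_iff (add_nonneg hg hh)] at h4

lemma eLpNorm_le_of_vanishing {f : ℝ → ℂ} (hf : Continuous f) {R : ℝ}
    (h : ∀ x, R < |x| → f x = 0) {p q : ℝ≥0∞} (hpq : p ≤ q) :
    eLpNorm f p volume ≤
      eLpNorm f q volume * ENNReal.ofReal (2 * R) ^ (1 / p.toReal - 1 / q.toReal) := by
  have hind : (Set.Icc (-R) R).indicator f = f := by
    rw [Set.indicator_eq_self]
    intro x hx
    by_contra hx'
    refine hx (h x ?_)
    rw [Set.mem_Icc, ← abs_le, not_le] at hx'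
    exact hx'
  have h1 := eLpNorm_le_eLpNorm_mul_rpow_measure_univ (μ := volume.restrict (Set.Icc (-R) R))
    hpq (hf.aestronglyMeasurable)
  rw [← eLpNorm_indicator_eq_eLpNorm_restrict measurableSet_Icc,
    ← eLpNorm_indicator_eq_eLpNorm_restrict measurableSet_Icc, hind, Measure.restrict_apply_univ,
    Real.volume_Icc] at h1
  convert h1 using 4
  ring

lemma l2Norm_le_of_bound {f : 𝓢(ℝ, ℂ)} {R X : ℝ} (hX : 0 ≤ X)
    (h : ∀ x, R < |x| → f x = 0) (hb : ∀ x, ‖f x‖ ≤ X) :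
    l2Norm f ≤ √(2 * R) * X := by
  have h1 := eLpNorm_le_of_vanishing f.continuous h (p := 2) (q := ⊤) le_top
  have h2 : eLpNorm f ⊤ volume ≤ ENNReal.ofReal X := by
    rw [eLpNorm_exponent_top]
    exact eLpNormEssSup_le_of_ae_bound (ae_of_all _ hb)
  have h3 := h1.trans (mul_le_mul_left h2 _)
  rw [schwartz_eLpNorm_eq] at h3
  have h4 : ENNReal.ofReal (2 * R) ^ (1 / (2 : ℝ≥0∞).toReal - 1 / (⊤ : ℝ≥0∞).toReal)
      = ENNReal.ofReal (√(2 * R)) := by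
    rcases le_or_gt 0 (2 * R) with hR | hR
    · rw [Real.sqrt_eq_rpow, ← ENNReal.ofReal_rpow_of_nonneg hR (by norm_num)]
      norm_num
    · rw [Real.sqrt_eq_zero_of_nonpos hR.le, ENNReal.ofReal_of_nonpos hR.le]
      norm_num
  rw [h4, ← ENNReal.ofReal_mul hX, ENNReal.ofReal_le_ofReal_iff (by positivity)] at h3
  linarith

lemma schwartz_l1Norm_le_of_vanishing {f : 𝓢(ℝ, ℂ)} {R : ℝ}
    (h : ∀ x, R < |x| → f x = 0) : ‖f.toLp 1‖ ≤ √(2 * R) * l2Norm f := by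
  have h1 := eLpNorm_le_of_vanishing f.continuous h (p := 1) (q := 2) (by norm_num)
  have h4 : ENNReal.ofReal (2 * R) ^ (1 / (1 : ℝ≥0∞).toReal - 1 / (2 : ℝ≥0∞).toReal)
      = ENNReal.ofReal (√(2 * R)) := by
    rcases le_or_gt 0 (2 * R) with hR | hR
    · rw [Real.sqrt_eq_rpow, ← ENNReal.ofReal_rpow_of_nonneg hR (by norm_num)]
      norm_num
    · rw [Real.sqrt_eq_zero_of_nonpos hR.le, ENNReal.ofReal_of_nonpos hR.le]
      norm_num
  rw [h4, schwartz_eLpNorm_eq, ← ENNReal.ofReal_mul (l2Norm_nonneg _)] at h1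
  rw [SchwartzMap.norm_toLp]
  refine ENNReal.toReal_le_of_le_ofReal (mul_nonneg (Real.sqrt_nonneg _) (l2Norm_nonneg f))
    (h1.trans_eq (by rw [mul_comm]))

lemma schwartz_norm_apply_le_fourier (f : 𝓢(ℝ, ℂ)) (x : ℝ) : ‖f x‖ ≤ ‖(𝓕 f).toLp 1‖ := by
  have h := (𝓕 f).norm_fourier_apply_le_toLp_one (-x)
  have h2 : 𝓕 (𝓕 f) (-x) = f x := by
    have := fourierInv_eq_fourier_neg (𝓕 f : 𝓢(ℝ, ℂ)) x
    rw [SchwartzMap.fourier_coe, ← this, ← SchwartzMap.fourierInv_coe,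
      FourierTransform.fourierInv_fourier_eq]
  rwa [h2] at h

lemma schwartz_bernstein {f : 𝓢(ℝ, ℂ)} {R : ℝ} (h : ∀ τ, R < |τ| → 𝓕 f τ = 0) (x : ℝ) :
    ‖f x‖ ≤ √(2 * R) * l2Norm f := by
  refine (schwartz_norm_apply_le_fourier f x).trans ?_
  have := schwartz_l1Norm_le_of_vanishing h
  rwa [l2Norm_fourier] at this

lemma schwartz_fourier_deriv (f : 𝓢(ℝ, ℂ)) (τ : ℝ) :
    𝓕 (SchwartzMap.derivCLM ℂ ℂ f) τ = 2 * π * Complex.I * τ * 𝓕 f τ := by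
  have h := Real.fourier_deriv f.integrable f.differentiable
    (SchwartzMap.derivCLM ℂ ℂ f).integrable
  rw [SchwartzMap.fourier_coe, SchwartzMap.fourier_coe]
  exact (congrFun h τ).trans (by simp)

end L2

section Multiplier

lemma fourier_multiplier_apply {m : ℝ → ℂ} (hm : m.HasTemperateGrowth) (f : 𝓢(ℝ, ℂ)) (τ : ℝ) :
    𝓕 (SchwartzMap.fourierMultiplierCLM ℂ m f) τ = m τ * 𝓕 f τ := by
  rw [SchwartzMap.fourierMultiplierCLM_apply, FourierTransform.fourier_fourierInv_eq,
    SchwartzMap.smulLeftCLM_apply_apply hm, smul_eq_mul]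

lemma schwartz_ext_fourier {f g : 𝓢(ℝ, ℂ)} (h : ∀ τ, 𝓕 f τ = 𝓕 g τ) : f = g := by
  have : 𝓕 f = 𝓕 g := by ext τ; exact h τ
  have h2 := congrArg (fun u : 𝓢(ℝ, ℂ) => (𝓕⁻ u : 𝓢(ℝ, ℂ))) this
  simpa using h2

lemma l2Norm_le_of_fourier {f g : 𝓢(ℝ, ℂ)} {c : ℝ}
    (h : ∀ τ, ‖𝓕 f τ‖ ≤ c * ‖𝓕 g τ‖) : l2Norm f ≤ c * l2Norm g := by
  have := l2Norm_le_mul h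
  rwa [l2Norm_fourier, l2Norm_fourier] at this

lemma hasTemperateGrowth_of_compactSupport {m : ℝ → ℂ} (h : ContDiff ℝ (⊤ : ℕ∞) m)
    (hc : HasCompactSupport m) : m.HasTemperateGrowth :=
  (hc.toSchwartzMap h).hasTemperateGrowth

end Multiplier

/-- A smooth bump equal to `1` on `[-1, 1]` and vanishing off `(-2, 2)`, with `B ≥ 1` bounding it
and its derivative. -/
structure IsCutoff (ψ : ℝ → ℝ) (B : ℝ) : Prop where
  smooth : ContDiff ℝ (⊤ : ℕ∞) ψ
  eq_zero : ∀ r, 2 ≤ |r| → ψ r = 0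
  eq_one : ∀ r, |r| ≤ 1 → ψ r = 1
  one_le : 1 ≤ B
  bound : ∀ r, |ψ r| ≤ B
  deriv_bound : ∀ r, |deriv ψ r| ≤ B

namespace IsCutoff

lemma exists_bound {ψ : ℝ → ℝ} (hs : ContDiff ℝ (⊤ : ℕ∞) ψ) (h0 : ∀ r, 2 ≤ |r| → ψ r = 0)
    (h1 : ∀ r, |r| ≤ 1 → ψ r = 1) : ∃ B, IsCutoff ψ B := by
  have hc : HasCompactSupport ψ := by
    refine HasCompactSupport.intro (isCompact_Icc (a := (-2 : ℝ)) (b := 2)) fun x hx => h0 x ?_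
    rw [Set.mem_Icc, ← abs_le, not_le] at hx
    exact hx.le
  obtain ⟨B₁, hB₁⟩ := hc.exists_bound_of_continuous hs.continuous
  obtain ⟨B₂, hB₂⟩ := hc.deriv.exists_bound_of_continuous (hs.continuous_deriv (by simp))
  exact ⟨max 1 (max B₁ B₂), hs, h0, h1, le_max_left _ _,
    fun r => (hB₁ r).trans ((le_max_left _ _).trans (le_max_right _ _)),
    fun r => (hB₂ r).trans ((le_max_right _ _).trans (le_max_right _ _))⟩

variable {ψ : ℝ → ℝ} {B : ℝ}

lemma nonneg (hψ : IsCutoff ψ B) : 0 ≤ B := zero_le_one.trans hψ.one_le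

lemma psiDy_contDiff (hψ : IsCutoff ψ B) (L : ℝ) : ContDiff ℝ (⊤ : ℕ∞) (psiDy ψ L) := by
  have h := hψ.smooth
  unfold psiDy
  split_ifs
  · exact h
  · exact (h.comp (contDiff_id.div_const L)).sub
      (h.comp ((contDiff_const.mul contDiff_id).div_const L))

lemma psiDy_abs_le (hψ : IsCutoff ψ B) (L r : ℝ) : |psiDy ψ L r| ≤ 2 * B := by
  have h1 := hψ.nonneg
  unfold psiDy
  split_ifs
  · linarith [hψ.bound r]
  · linarith [hψ.bound (r / L), hψ.bound (2 * r / L), abs_sub (ψ (r / L)) (ψ (2 * r / L))]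

lemma psiDy_eq_zero_of_ge (hψ : IsCutoff ψ B) {L r : ℝ} (hL : 0 < L) (h : 2 * L ≤ |r|) :
    psiDy ψ L r = 0 := by
  unfold psiDy
  split_ifs with h1
  · exact hψ.eq_zero r (by linarith)
  · have h2 : 2 ≤ |r / L| := by rwa [abs_div, abs_of_pos hL, le_div_iff₀ hL]
    have h3 : 2 ≤ |2 * r / L| := by
      rw [mul_div_assoc, abs_mul, abs_two]
      linarith
    rw [hψ.eq_zero _ h2, hψ.eq_zero _ h3, sub_zero]

lemma psiDy_eq_zero_of_le (hψ : IsCutoff ψ B) {L r : ℝ} (hL : 1 < L) (h : 2 * |r| ≤ L) :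
    psiDy ψ L r = 0 := by
  have hL0 : 0 < L := by linarith
  have h3 : |2 * r / L| ≤ 1 := by
    rwa [abs_div, abs_mul, abs_two, abs_of_pos hL0, div_le_one hL0]
  have h2 : |r / L| ≤ 1 := by
    rw [mul_div_assoc, abs_mul, abs_two] at h3
    linarith [abs_nonneg (r / L)]
  rw [psiDy, if_neg hL.ne', hψ.eq_one _ h2, hψ.eq_one _ h3, sub_self]

lemma psiDy_abs_le_mul (hψ : IsCutoff ψ B) {L r : ℝ} (hL : 1 < L) :
    |psiDy ψ L r| ≤ 4 * B / L * |r| := by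
  have h1 := hψ.nonneg
  rcases le_or_gt (2 * |r|) L with h | h
  · rw [hψ.psiDy_eq_zero_of_le hL h, abs_zero]
    positivity
  · refine (hψ.psiDy_abs_le L r).trans ?_
    rw [div_mul_eq_mul_div, le_div_iff₀ (by linarith)]
    nlinarith

lemma sum_psiDy (ψ : ℝ → ℝ) (K : ℕ) (r : ℝ) :
    ∑ m ∈ Finset.range (K + 1), psiDy ψ ((2 : ℝ) ^ m) r = ψ (r / 2 ^ K) := by
  induction K with
  | zero => simp [psiDy]
  | succ K ih =>
    rw [Finset.sum_range_succ, ih, psiDy, if_neg (one_lt_pow₀ one_lt_two (Nat.succ_ne_zero K)).ne']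
    have : 2 * r / 2 ^ (K + 1) = r / 2 ^ K := by
      rw [pow_succ]
      field_simp
    rw [this]
    ring

lemma psiDy_hasTemperateGrowth (hψ : IsCutoff ψ B) {L : ℝ} (hL : 0 < L) :
    (fun τ => (psiDy ψ L τ : ℂ)).HasTemperateGrowth := by
  refine hasTemperateGrowth_of_compactSupport
    (Complex.ofRealCLM.contDiff.comp (hψ.psiDy_contDiff L))
    (HasCompactSupport.intro (isCompact_Icc (a := -(2 * L)) (b := 2 * L)) fun x hx => ?_)
  rw [Set.mem_Icc, ← abs_le, not_le] at hx
  rw [hψ.psiDy_eq_zero_of_ge hL hx.le, Complex.ofReal_zero]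

end IsCutoff

/-- The Littlewood-Paley piece at frequency `2 ^ l`, as a Schwartz function. -/
def dyadicPiece (ψ : ℝ → ℝ) (l : ℕ) : 𝓢(ℝ, ℂ) →L[ℂ] 𝓢(ℝ, ℂ) :=
  SchwartzMap.fourierMultiplierCLM ℂ (fun τ => (psiDy ψ ((2 : ℝ) ^ l) τ : ℂ))

section Besov

variable {ψ : ℝ → ℝ} {B : ℝ}

lemma fourier_dyadicPiece (hψ : IsCutoff ψ B) (l : ℕ) (f : 𝓢(ℝ, ℂ)) (τ : ℝ) :
    𝓕 (dyadicPiece ψ l f) τ = (psiDy ψ ((2 : ℝ) ^ l) τ : ℂ) * 𝓕 f τ :=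
  fourier_multiplier_apply (hψ.psiDy_hasTemperateGrowth (by positivity)) f τ

lemma coe_dyadicPiece (hψ : IsCutoff ψ B) (l : ℕ) (f : 𝓢(ℝ, ℂ)) :
    PL ψ ((2 : ℝ) ^ l) f = dyadicPiece ψ l f := by
  unfold dyadicPiece PL
  rw [SchwartzMap.fourierMultiplierCLM_apply, SchwartzMap.fourierInv_coe,
    SchwartzMap.smulLeftCLM_apply (hψ.psiDy_hasTemperateGrowth (by positivity))]
  rfl

lemma dyadicPiece_norm_le (hψ : IsCutoff ψ B) (l : ℕ) (f : 𝓢(ℝ, ℂ)) :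
    l2Norm (dyadicPiece ψ l f) ≤ 2 * B * l2Norm f := by
  refine l2Norm_le_of_fourier fun τ => ?_
  rw [fourier_dyadicPiece hψ, norm_mul, Complex.norm_real]
  gcongr
  exact hψ.psiDy_abs_le _ _

lemma dyadicPiece_norm_le_deriv (hψ : IsCutoff ψ B) {l : ℕ} (hl : l ≠ 0) (f : 𝓢(ℝ, ℂ)) :
    l2Norm (dyadicPiece ψ l f) ≤
      2 * B / 2 ^ l * l2Norm (SchwartzMap.derivCLM ℂ ℂ f) := by
  have hB := hψ.nonneg
  refine l2Norm_le_of_fourier fun τ => ?_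
  rw [fourier_dyadicPiece hψ, norm_mul, Complex.norm_real, schwartz_fourier_deriv, norm_mul,
    ← mul_assoc]
  refine mul_le_mul_of_nonneg_right ?_ (norm_nonneg _)
  refine (hψ.psiDy_abs_le_mul (one_lt_pow₀ one_lt_two hl)).trans ?_
  simp only [norm_mul, Complex.norm_ofNat, Complex.norm_real, Complex.norm_I, Real.norm_eq_abs,
    abs_of_pos Real.pi_pos, mul_one]
  have : 4 * B / 2 ^ l * |τ| = 2 * B / 2 ^ l * (2 * 1 * |τ|) := by ring
  rw [this]
  gcongr
  linarith [Real.pi_gt_three]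

lemma sum_geometric_dist_le {r : ℝ} (h0 : 0 ≤ r) (h1 : r < 1) (a n : ℕ) :
    ∑ l ∈ Finset.range n, r ^ (l - a) * r ^ (a - l) ≤ 2 / (1 - r) := by
  have hgeom : ∀ n : ℕ, ∑ l ∈ Finset.range n, r ^ l ≤ 1 / (1 - r) := by
    intro n
    rw [one_div]
    exact (summable_geometric_of_lt_one h0 h1).sum_le_tsum _ (fun _ _ => by positivity)
      |>.trans_eq (tsum_geometric_of_lt_one h0 h1)
  have key : ∀ a n : ℕ, ∑ l ∈ Finset.range n, r ^ (l - a) * r ^ (a - l) ≤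
      1 / (1 - r) + ∑ j ∈ Finset.range a, r ^ (j + 1) := by
    intro a
    induction a with
    | zero => intro n; simpa using hgeom n
    | succ a ih =>
      intro n
      cases n with
      | zero =>
        have : 0 < 1 - r := by linarith
        simp only [Finset.range_zero, Finset.sum_empty]
        positivity
      | succ n =>
        rw [Finset.sum_range_succ', Finset.sum_range_succ (n := a)]
        simp only [Nat.add_sub_add_right, zero_tsub, pow_zero, one_mul, tsub_zero]
        linarith [ih n]
  have h2 : ∑ j ∈ Finset.range a, r ^ (j + 1) ≤ 1 / (1 - r) := by
    refine le_trans ?_ (hgeom a)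
    exact Finset.sum_le_sum fun j _ => pow_le_pow_of_le_one h0 h1.le (Nat.le_succ j)
  have h3 := key a n
  have h4 : 2 / (1 - r) = 1 / (1 - r) + 1 / (1 - r) := by ring
  linarith

lemma Bnorm1_add_le (hψ : IsCutoff ψ B) (b : ℝ) (f g : 𝓢(ℝ, ℂ)) :
    Bnorm1 ψ b ⇑(f + g) ≤ Bnorm1 ψ b f + Bnorm1 ψ b g := by
  unfold Bnorm1
  rw [← ENNReal.tsum_add]
  refine ENNReal.tsum_le_tsum fun l => ?_
  rw [← mul_add, coe_dyadicPiece hψ, coe_dyadicPiece hψ, coe_dyadicPiece hψ, map_add]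
  gcongr
  exact eLpNorm_add_le (dyadicPiece ψ l f).continuous.aestronglyMeasurable
    (dyadicPiece ψ l g).continuous.aestronglyMeasurable (by norm_num)

lemma two_pow_rpow_half (l : ℕ) : ((2 : ℝ) ^ l) ^ ((1 : ℝ) / 2) = √2 ^ l := by
  rw [Real.sqrt_eq_rpow, ← Real.rpow_natCast, ← Real.rpow_natCast, ← Real.rpow_mul zero_le_two,
    ← Real.rpow_mul zero_le_two, mul_comm]

lemma sqrt_two_pow_mul_le {p B X Y : ℝ} (hB : 0 ≤ B) (hX : 0 ≤ X) (hY : 0 ≤ Y) {l : ℕ} (a : ℕ)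
    (h1 : p ≤ 2 * B * X) (h2 : l ≠ 0 → p ≤ 2 * B / 2 ^ l * Y) :
    √2 ^ l * p ≤ (√2)⁻¹ ^ (l - a) * (√2)⁻¹ ^ (a - l) *
      (2 * B * (√2 ^ a * X + (√2 ^ a)⁻¹ * Y)) := by
  have hs0 : 0 < √2 := by positivity
  have hs2 : (2 : ℝ) = √2 ^ 2 := (Real.sq_sqrt zero_le_two).symm
  rcases le_or_gt l a with hl | hl
  · obtain ⟨d, rfl⟩ := Nat.exists_eq_add_of_le hl
    rw [Nat.sub_eq_zero_of_le hl, Nat.add_sub_cancel_left, pow_zero, one_mul, inv_pow]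
    calc √2 ^ l * p ≤ √2 ^ l * (2 * B * X) := mul_le_mul_of_nonneg_left h1 (by positivity)
      _ = (√2 ^ d)⁻¹ * (2 * B * (√2 ^ (l + d) * X + 0)) := by
        rw [pow_add, add_zero]
        field_simp
      _ ≤ _ := by
        gcongr
        positivity
  · obtain ⟨d, rfl⟩ := Nat.exists_eq_add_of_le hl.le
    rw [Nat.sub_eq_zero_of_le hl.le, Nat.add_sub_cancel_left, pow_zero, mul_one, inv_pow]
    have h3 : (2 : ℝ) ^ (a + d) = (√2 ^ a * √2 ^ d) ^ 2 := by
      rw [← pow_add, ← pow_mul, mul_comm, pow_mul, ← hs2]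
    calc √2 ^ (a + d) * p ≤ √2 ^ (a + d) * (2 * B / 2 ^ (a + d) * Y) :=
          mul_le_mul_of_nonneg_left (h2 (Nat.ne_zero_of_lt hl)) (by positivity)
      _ = (√2 ^ d)⁻¹ * (2 * B * (0 + (√2 ^ a)⁻¹ * Y)) := by
        rw [h3, pow_add, zero_add]
        field_simp
      _ ≤ _ := by
        gcongr
        positivity

lemma sqrt_two_pow_mul_dyadicPiece_norm_le (hψ : IsCutoff ψ B) (a l : ℕ) (f : 𝓢(ℝ, ℂ)) :
    √2 ^ l * l2Norm (dyadicPiece ψ l f) ≤ (√2)⁻¹ ^ (l - a) * (√2)⁻¹ ^ (a - l) * (2 * B *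
      (√2 ^ a * l2Norm f + (√2 ^ a)⁻¹ * l2Norm (SchwartzMap.derivCLM ℂ ℂ f))) :=
  sqrt_two_pow_mul_le hψ.nonneg (l2Norm_nonneg _) (l2Norm_nonneg _) a (dyadicPiece_norm_le hψ l f)
    fun hl => dyadicPiece_norm_le_deriv hψ hl f

lemma sum_sqrt_two_pow_mul_dyadicPiece_norm_le (hψ : IsCutoff ψ B) (a n : ℕ) (f : 𝓢(ℝ, ℂ)) :
    ∑ l ∈ Finset.range n, √2 ^ l * l2Norm (dyadicPiece ψ l f) ≤ 2 / (1 - (√2)⁻¹) * (2 * B *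
      (√2 ^ a * l2Norm f + (√2 ^ a)⁻¹ * l2Norm (SchwartzMap.derivCLM ℂ ℂ f))) := by
  have hB := hψ.nonneg
  refine (Finset.sum_le_sum fun l _ => sqrt_two_pow_mul_dyadicPiece_norm_le hψ a l f).trans ?_
  have hX := l2Norm_nonneg f
  have hY := l2Norm_nonneg (SchwartzMap.derivCLM ℂ ℂ f)
  rw [← Finset.sum_mul]
  exact mul_le_mul_of_nonneg_right
    (sum_geometric_dist_le (by positivity) (inv_lt_one_of_one_lt₀ Real.one_lt_sqrt_two) a n)
    (by positivity)

lemma Bnorm1_half_le_of_forall_sum_le (hψ : IsCutoff ψ B) {f : 𝓢(ℝ, ℂ)} {X : ℝ}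
    (h : ∀ n, ∑ l ∈ Finset.range n, √2 ^ l * l2Norm (dyadicPiece ψ l f) ≤ X) :
    Bnorm1 ψ (1 / 2) f ≤ ENNReal.ofReal X := by
  unfold Bnorm1
  refine ENNReal.tsum_le_of_sum_range_le fun n => ?_
  refine le_trans (le_of_eq ?_) (ENNReal.ofReal_le_ofReal (h n))
  rw [ENNReal.ofReal_sum_of_nonneg fun _ _ => mul_nonneg (by positivity) (l2Norm_nonneg _)]
  refine Finset.sum_congr rfl fun l _ => ?_
  rw [coe_dyadicPiece hψ, schwartz_eLpNorm_eq, two_pow_rpow_half,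
    ENNReal.ofReal_mul (by positivity)]

/-- The constant in `Bnorm1_half_le`. -/
def besovConst (B : ℝ) : ℝ := 2 / (1 - (√2)⁻¹) * (2 * B)

lemma besovConst_nonneg (hB : 0 ≤ B) : 0 ≤ besovConst B := by
  have : (√2)⁻¹ < 1 := inv_lt_one_of_one_lt₀ Real.one_lt_sqrt_two
  have h2 : 0 < 1 - (√2)⁻¹ := by linarith
  unfold besovConst
  positivity

/-- Interpolation of `B^{1/2}_{2,1}` between `L²` and `Ḣ¹`, with a free dyadic parameter. -/
lemma Bnorm1_half_le (hψ : IsCutoff ψ B) (a : ℕ) (f : 𝓢(ℝ, ℂ)) :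
    Bnorm1 ψ (1 / 2) f ≤ ENNReal.ofReal (besovConst B *
      (√2 ^ a * l2Norm f + (√2 ^ a)⁻¹ * l2Norm (SchwartzMap.derivCLM ℂ ℂ f))) := by
  unfold besovConst
  rw [mul_assoc]
  exact Bnorm1_half_le_of_forall_sum_le hψ fun n =>
    sum_sqrt_two_pow_mul_dyadicPiece_norm_le hψ a n f

end Besov

section Localized

variable {ψ : ℝ → ℝ} {B T : ℝ}

lemma IsCutoff.scaled_eq_zero (hψ : IsCutoff ψ B) (hT : 0 < T) {t : ℝ} (ht : 2 * T ≤ |t|) :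
    ψ (t / T) = 0 :=
  hψ.eq_zero _ (by rwa [abs_div, abs_of_pos hT, le_div_iff₀ hT])

lemma IsCutoff.scaled_contDiff (hψ : IsCutoff ψ B) (T : ℝ) :
    ContDiff ℝ (⊤ : ℕ∞) (fun t => (ψ (t / T) : ℂ)) :=
  Complex.ofRealCLM.contDiff.comp (hψ.smooth.comp (contDiff_id.div_const T))

lemma IsCutoff.scaled_hasDerivAt (hψ : IsCutoff ψ B) (T t : ℝ) :
    HasDerivAt (fun t => (ψ (t / T) : ℂ)) ((deriv ψ (t / T) * (1 / T) : ℝ) : ℂ) t := by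
  have h1 : HasDerivAt ψ (deriv ψ (t / T)) (t / T) :=
    (hψ.smooth.differentiable (by simp) _).hasDerivAt
  exact (h1.comp t ((hasDerivAt_id t).div_const T)).ofReal_comp

lemma exists_schwartz_localized (hψ : IsCutoff ψ B) (hT : 0 < T) {u : ℝ → ℂ}
    (hu : ContDiff ℝ (⊤ : ℕ∞) u) : ∃ F : 𝓢(ℝ, ℂ), ⇑F = fun t => (ψ (t / T) : ℂ) * u t := by
  have hc : HasCompactSupport (fun t => (ψ (t / T) : ℂ) * u t) := by
    refine HasCompactSupport.intro (isCompact_Icc (a := -(2 * T)) (b := 2 * T)) fun x hx => ?_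
    rw [Set.mem_Icc, ← abs_le, not_le] at hx
    rw [hψ.scaled_eq_zero hT hx.le, Complex.ofReal_zero, zero_mul]
  exact ⟨hc.toSchwartzMap ((hψ.scaled_contDiff T).mul hu), rfl⟩

lemma localized_norm_le (hψ : IsCutoff ψ B) (t : ℝ) (z : ℂ) :
    ‖(ψ (t / T) : ℂ) * z‖ ≤ B * ‖z‖ := by
  rw [norm_mul, Complex.norm_real]
  exact mul_le_mul_of_nonneg_right (hψ.bound _) (norm_nonneg _)

lemma localized_deriv_norm_le (hψ : IsCutoff ψ B) (hT : 0 < T) {u : ℝ → ℂ}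
    (hu : ContDiff ℝ (⊤ : ℕ∞) u) {F : 𝓢(ℝ, ℂ)} (hF : ⇑F = fun t => (ψ (t / T) : ℂ) * u t)
    (t : ℝ) : ‖SchwartzMap.derivCLM ℂ ℂ F t‖ ≤ B / T * ‖u t‖ + B * ‖deriv u t‖ := by
  have h1 := (hψ.scaled_hasDerivAt T t).mul (hu.differentiable (by simp) t).hasDerivAt
  have h2 : SchwartzMap.derivCLM ℂ ℂ F t =
      ((deriv ψ (t / T) * (1 / T) : ℝ) : ℂ) * u t + (ψ (t / T) : ℂ) * deriv u t := by
    rw [SchwartzMap.derivCLM_apply, hF]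
    exact h1.deriv
  rw [h2]
  refine (norm_add_le _ _).trans (add_le_add ?_ (localized_norm_le hψ t _))
  rw [norm_mul, Complex.norm_real, norm_mul, Real.norm_eq_abs, Real.norm_eq_abs,
    abs_of_pos (one_div_pos.2 hT), mul_one_div]
  gcongr
  exact hψ.deriv_bound _

lemma localized_deriv_eq_zero (hψ : IsCutoff ψ B) (hT : 0 < T) {u : ℝ → ℂ} {F : 𝓢(ℝ, ℂ)}
    (hF : ⇑F = fun t => (ψ (t / T) : ℂ) * u t) (t : ℝ) (ht : 2 * T < |t|) :
    SchwartzMap.derivCLM ℂ ℂ F t = 0 := by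
  rw [SchwartzMap.derivCLM_apply]
  have h : ⇑F =ᶠ[nhds t] fun _ => (0 : ℂ) := by
    filter_upwards [(isOpen_lt continuous_const continuous_abs).mem_nhds ht] with s hs
    rw [hF]
    simp only
    rw [hψ.scaled_eq_zero hT (le_of_lt hs), Complex.ofReal_zero, zero_mul]
  rw [h.deriv_eq, deriv_const]

lemma sqrt_two_pow_eq (a : ℕ) : √2 ^ a = √(2 ^ a) := by
  refine ((Real.sqrt_eq_iff_mul_self_eq (by positivity) (by positivity)).2 ?_).symm
  rw [← mul_pow, Real.mul_self_sqrt zero_le_two]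

lemma exists_dyadic_scale (hT : 0 < T) (hT1 : T ≤ 1) :
    ∃ a : ℕ, (2 : ℝ) ^ a * T ≤ 1 ∧ 1 < 2 ^ (a + 1) * T := by
  obtain ⟨a, h1, h2⟩ := exists_nat_pow_near (one_le_one_div hT hT1) (one_lt_two (α := ℝ))
  exact ⟨a, (le_div_iff₀ hT).1 h1, (div_lt_iff₀ hT).1 h2⟩

lemma Bnorm1_localized_le_of_bounded (hψ : IsCutoff ψ B) (hT : 0 < T) (hT1 : T ≤ 1) {u : ℝ → ℂ}
    (hu : ContDiff ℝ (⊤ : ℕ∞) u) {U V : ℝ} (hU0 : 0 ≤ U) (hV0 : 0 ≤ V)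
    (hU : ∀ t, |t| ≤ 2 * T → ‖u t‖ ≤ U) (hV : ∀ t, |t| ≤ 2 * T → ‖deriv u t‖ ≤ V) :
    Bnorm1 ψ (1 / 2) (fun t => (ψ (t / T) : ℂ) * u t) ≤
      ENNReal.ofReal (besovConst B * (B * (5 * U + 3 * T * V))) := by
  have hB := hψ.nonneg
  obtain ⟨a, ha1, ha2⟩ := exists_dyadic_scale hT hT1
  obtain ⟨F, hF⟩ := exists_schwartz_localized hψ hT hu
  have hF0 : ∀ t, 2 * T < |t| → F t = 0 := by
    intro t ht
    rw [hF]
    simp only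
    rw [hψ.scaled_eq_zero hT ht.le, Complex.ofReal_zero, zero_mul]
  have h1 : l2Norm F ≤ √(2 * (2 * T)) * (B * U) := by
    refine l2Norm_le_of_bound (by positivity) hF0 fun t => ?_
    rcases le_or_gt |t| (2 * T) with ht | ht
    · rw [hF]
      exact (localized_norm_le hψ t _).trans (mul_le_mul_of_nonneg_left (hU t ht) hB)
    · rw [hF0 t ht, norm_zero]
      positivity
  have h2 : l2Norm (SchwartzMap.derivCLM ℂ ℂ F) ≤
      √(2 * (2 * T)) * (B / T * U + B * V) := by
    refine l2Norm_le_of_bound (by positivity)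
      (localized_deriv_eq_zero hψ hT hF) fun t => ?_
    rcases le_or_gt |t| (2 * T) with ht | ht
    · refine (localized_deriv_norm_le hψ hT hu hF t).trans ?_
      have := hU t ht
      have := hV t ht
      gcongr
    · rw [localized_deriv_eq_zero hψ hT hF t ht, norm_zero]
      positivity
  have h3 : √2 ^ a * √(2 * (2 * T)) ≤ 2 := by
    rw [sqrt_two_pow_eq, ← Real.sqrt_mul (by positivity)]
    refine Real.sqrt_le_iff.2 ⟨by norm_num, ?_⟩
    linarith
  have h4 : (√2 ^ a)⁻¹ * √(2 * (2 * T)) ≤ 3 * T := by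
    rw [inv_mul_le_iff₀ (by positivity), sqrt_two_pow_eq]
    refine Real.sqrt_le_iff.2 ⟨by positivity, ?_⟩
    rw [mul_pow, Real.sq_sqrt (by positivity)]
    rw [pow_succ] at ha2
    nlinarith
  rw [← hF]
  refine (Bnorm1_half_le hψ a F).trans (ENNReal.ofReal_le_ofReal ?_)
  refine mul_le_mul_of_nonneg_left ?_ (besovConst_nonneg hB)
  calc √2 ^ a * l2Norm F + (√2 ^ a)⁻¹ * l2Norm (SchwartzMap.derivCLM ℂ ℂ F)
      ≤ √2 ^ a * (√(2 * (2 * T)) * (B * U)) +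
        (√2 ^ a)⁻¹ * (√(2 * (2 * T)) * (B / T * U + B * V)) :=
        add_le_add (mul_le_mul_of_nonneg_left h1 (by positivity))
          (mul_le_mul_of_nonneg_left h2 (by positivity))
    _ = (√2 ^ a * √(2 * (2 * T))) * (B * U) +
        ((√2 ^ a)⁻¹ * √(2 * (2 * T))) * (B / T * U + B * V) := by ring
    _ ≤ 2 * (B * U) + (3 * T) * (B / T * U + B * V) :=
        add_le_add (mul_le_mul_of_nonneg_right h3 (by positivity))
          (mul_le_mul_of_nonneg_right h4 (by positivity))
    _ = B * (5 * U + 3 * T * V) := by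
        field_simp
        ring

lemma Bnorm1_localized_schwartz_le (hψ : IsCutoff ψ B) (hT : 0 < T) {m : ℕ}
    (hm : 1 ≤ 2 ^ m * T) (h : 𝓢(ℝ, ℂ)) :
    Bnorm1 ψ (1 / 2) (fun t => (ψ (t / T) : ℂ) * h t) ≤
      ENNReal.ofReal (besovConst B * (B * (2 * √2 ^ m * l2Norm h +
        (√2 ^ m)⁻¹ * l2Norm (SchwartzMap.derivCLM ℂ ℂ h)))) := by
  have hB := hψ.nonneg
  obtain ⟨F, hF⟩ := exists_schwartz_localized hψ hT (h.smooth ⊤)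
  have h1 : l2Norm F ≤ B * l2Norm h := by
    refine l2Norm_le_mul fun t => ?_
    rw [hF]
    exact localized_norm_le hψ t _
  have h2 : l2Norm (SchwartzMap.derivCLM ℂ ℂ F) ≤
      B / T * l2Norm h + B * l2Norm (SchwartzMap.derivCLM ℂ ℂ h) :=
    l2Norm_le_add (by positivity) hB
      (localized_deriv_norm_le hψ hT (h.smooth ⊤) hF)
  have h3 : B / T ≤ B * 2 ^ m := by
    rw [div_le_iff₀ hT]
    nlinarith
  have h4 : (2 : ℝ) ^ m = √2 ^ m * √2 ^ m := by
    rw [← mul_pow, Real.mul_self_sqrt zero_le_two]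
  have hX := l2Norm_nonneg h
  have hY := l2Norm_nonneg (SchwartzMap.derivCLM ℂ ℂ h)
  rw [← hF]
  refine (Bnorm1_half_le hψ m F).trans (ENNReal.ofReal_le_ofReal ?_)
  refine mul_le_mul_of_nonneg_left ?_ (besovConst_nonneg hB)
  generalize l2Norm h = X at *
  generalize l2Norm (SchwartzMap.derivCLM ℂ ℂ h) = Y at *
  have h5 : B / T * X + B * Y ≤ B * 2 ^ m * X + B * Y := by gcongr
  calc _ ≤ √2 ^ m * (B * X) + (√2 ^ m)⁻¹ * (B * 2 ^ m * X + B * Y) :=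
        add_le_add (mul_le_mul_of_nonneg_left h1 (by positivity))
          (mul_le_mul_of_nonneg_left (h2.trans h5) (by positivity))
    _ = B * (2 * √2 ^ m * X + (√2 ^ m)⁻¹ * Y) := by
        rw [h4]
        field_simp
        ring

end Localized

section Duhamel

variable {ψ : ℝ → ℝ} {B T : ℝ}

lemma schwartz_primitive_hasDerivAt (g : 𝓢(ℝ, ℂ)) (t : ℝ) :
    HasDerivAt (fun t => ∫ t' in (0 : ℝ)..t, g t') (g t) t :=
  (g.continuous.integral_hasStrictDerivAt 0 t).hasDerivAt

lemma schwartz_primitive_contDiff (g : 𝓢(ℝ, ℂ)) :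
    ContDiff ℝ (⊤ : ℕ∞) (fun t => ∫ t' in (0 : ℝ)..t, g t') := by
  rw [contDiff_infty_iff_deriv]
  refine ⟨fun t => (schwartz_primitive_hasDerivAt g t).differentiableAt, ?_⟩
  rw [show deriv (fun t => ∫ t' in (0 : ℝ)..t, g t') = g from
    funext fun t => (schwartz_primitive_hasDerivAt g t).deriv]
  exact g.smooth ⊤

/-- The Duhamel operator localized to `|t| ≤ 2T`. -/
def duhamel (ψ : ℝ → ℝ) (T : ℝ) (g : 𝓢(ℝ, ℂ)) : ℝ → ℂ :=
  fun t => (ψ (t / T) : ℂ) * ∫ t' in (0 : ℝ)..t, g t'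

lemma Bnorm1_duhamel_add_le (hψ : IsCutoff ψ B) (hT : 0 < T) (f g : 𝓢(ℝ, ℂ)) :
    Bnorm1 ψ (1 / 2) (duhamel ψ T (f + g)) ≤
      Bnorm1 ψ (1 / 2) (duhamel ψ T f) + Bnorm1 ψ (1 / 2) (duhamel ψ T g) := by
  obtain ⟨F, hF⟩ := exists_schwartz_localized hψ hT (schwartz_primitive_contDiff f)
  obtain ⟨G, hG⟩ := exists_schwartz_localized hψ hT (schwartz_primitive_contDiff g)
  have h : duhamel ψ T (f + g) = ⇑(F + G) := by
    ext t
    simp only [duhamel, add_apply]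
    rw [intervalIntegral.integral_add (f.continuous.intervalIntegrable _ _)
      (g.continuous.intervalIntegrable _ _), hF, hG, mul_add]
  have hF' : duhamel ψ T f = ⇑F := hF.symm
  have hG' : duhamel ψ T g = ⇑G := hG.symm
  rw [h, hF', hG']
  exact Bnorm1_add_le hψ _ F G

lemma Bnorm1_duhamel_le_sum_add (hψ : IsCutoff ψ B) (hT : 0 < T) (g : 𝓢(ℝ, ℂ))
    (p : ℕ → 𝓢(ℝ, ℂ)) (n : ℕ) :
    Bnorm1 ψ (1 / 2) (duhamel ψ T g) ≤
      ∑ m ∈ Finset.range n, Bnorm1 ψ (1 / 2) (duhamel ψ T (p m)) +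
        Bnorm1 ψ (1 / 2) (duhamel ψ T (g - ∑ m ∈ Finset.range n, p m)) := by
  induction n with
  | zero => simp
  | succ n ih =>
    refine ih.trans ?_
    rw [Finset.sum_range_succ, Finset.sum_range_succ, add_assoc]
    gcongr
    have h : g - ∑ m ∈ Finset.range n, p m =
        p n + (g - (∑ m ∈ Finset.range n, p m + p n)) := by abel
    conv_lhs => rw [h]
    exact Bnorm1_duhamel_add_le hψ hT _ _

lemma Bnorm1_duhamel_le_of_bounded (hψ : IsCutoff ψ B) (hT : 0 < T) (hT1 : T ≤ 1)
    {g : 𝓢(ℝ, ℂ)} {X : ℝ} (hX : ∀ t, ‖g t‖ ≤ X) :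
    Bnorm1 ψ (1 / 2) (duhamel ψ T g) ≤ ENNReal.ofReal (besovConst B * (B * (13 * T * X))) := by
  have hX0 : 0 ≤ X := (norm_nonneg _).trans (hX 0)
  refine (Bnorm1_localized_le_of_bounded hψ hT hT1 (schwartz_primitive_contDiff g)
    (U := 2 * T * X) (V := X) (by positivity) hX0 (fun t ht => ?_) (fun t _ => ?_)).trans_eq ?_
  · refine (intervalIntegral.norm_integral_le_of_norm_le_const (C := X)
      (fun s _ => hX s)).trans ?_
    rw [sub_zero, mul_comm]
    gcongr
  · rw [(schwartz_primitive_hasDerivAt g t).deriv]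
    exact hX t
  · congr 3
    ring

lemma Bnorm1_duhamel_deriv_le (hψ : IsCutoff ψ B) (hT : 0 < T) (hT1 : T ≤ 1) {m : ℕ}
    (hm : 1 ≤ 2 ^ m * T) (h : 𝓢(ℝ, ℂ)) :
    Bnorm1 ψ (1 / 2) (duhamel ψ T (SchwartzMap.derivCLM ℂ ℂ h)) ≤
      ENNReal.ofReal (besovConst B * (B * (2 * √2 ^ m * l2Norm h +
        (√2 ^ m)⁻¹ * l2Norm (SchwartzMap.derivCLM ℂ ℂ h) + 5 * ‖h 0‖))) := by
  have hB := hψ.nonneg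
  have hK := besovConst_nonneg hB
  have hX := l2Norm_nonneg h
  have hY := l2Norm_nonneg (SchwartzMap.derivCLM ℂ ℂ h)
  obtain ⟨F, hF⟩ := exists_schwartz_localized hψ hT (h.smooth ⊤)
  obtain ⟨G, hG⟩ := exists_schwartz_localized hψ hT
    (contDiff_const (c := -h 0) : ContDiff ℝ (⊤ : ℕ∞) fun _ : ℝ => -h 0)
  have h1 : duhamel ψ T (SchwartzMap.derivCLM ℂ ℂ h) = ⇑(F + G) := by
    ext t
    have h2 : ∫ t' in (0 : ℝ)..t, SchwartzMap.derivCLM ℂ ℂ h t' = h t - h 0 :=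
      intervalIntegral.integral_eq_sub_of_hasDerivAt (fun s _ => h.hasDerivAt s)
        ((SchwartzMap.derivCLM ℂ ℂ h).continuous.intervalIntegrable _ _)
    simp only [duhamel, add_apply]
    rw [h2, hF, hG]
    ring
  have hF1 := Bnorm1_localized_schwartz_le hψ hT hm h
  have hG1 := Bnorm1_localized_le_of_bounded hψ hT hT1 (u := fun _ : ℝ => -h 0) contDiff_const
    (norm_nonneg (h 0)) le_rfl (fun t _ => (norm_neg _).le) (fun t _ => by simp)
  rw [← hF] at hF1
  rw [← hG] at hG1
  rw [h1]
  refine (Bnorm1_add_le hψ _ F G).trans ((add_le_add hF1 hG1).trans_eq ?_)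
  rw [← ENNReal.ofReal_add (by positivity) (by positivity)]
  congr 1
  ring

/-- Frequency-localized functions away from zero frequency have good primitives. -/
lemma exists_primitive_dyadicPiece (hψ : IsCutoff ψ B) {m : ℕ} (hm : m ≠ 0) (g : 𝓢(ℝ, ℂ)) :
    ∃ h : 𝓢(ℝ, ℂ), SchwartzMap.derivCLM ℂ ℂ h = dyadicPiece ψ m g ∧
      l2Norm h ≤ (2 ^ m)⁻¹ * l2Norm (dyadicPiece ψ m g) ∧
      ‖h 0‖ ≤ √(2 * (2 * 2 ^ m)) * l2Norm h := by
  have hL : (1 : ℝ) < 2 ^ m := one_lt_pow₀ one_lt_two hm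
  have hL0 : (0 : ℝ) < 2 ^ m := by positivity
  set μ : ℝ → ℂ := fun τ => (psiDy ψ (2 ^ m) τ : ℂ) / (2 * π * Complex.I * τ) with hμ
  have hμ0 : ∀ τ, psiDy ψ (2 ^ m) τ = 0 → μ τ = 0 := fun τ h => by simp [hμ, h]
  have hμ1 : ContDiff ℝ (⊤ : ℕ∞) μ := by
    rw [contDiff_iff_contDiffAt]
    intro τ
    rcases eq_or_ne τ 0 with rfl | hτ
    · refine (contDiffAt_const (c := (0 : ℂ))).congr_of_eventuallyEq ?_
      filter_upwards [Metric.ball_mem_nhds (0 : ℝ) (half_pos hL0)] with s hs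
      refine hμ0 s (hψ.psiDy_eq_zero_of_le hL ?_)
      rw [Metric.mem_ball, dist_zero_right, Real.norm_eq_abs] at hs
      linarith
    · have h1 : ContDiff ℝ (⊤ : ℕ∞) (fun τ : ℝ => (psiDy ψ (2 ^ m) τ : ℂ)) :=
        Complex.ofRealCLM.contDiff.comp (hψ.psiDy_contDiff _)
      have h2 : ContDiff ℝ (⊤ : ℕ∞) (fun τ : ℝ => 2 * π * Complex.I * (τ : ℂ)) := by
        refine ContDiff.mul contDiff_const ?_
        exact Complex.ofRealCLM.contDiff
      have h3 : 2 * π * Complex.I * (τ : ℂ) ≠ 0 := by simp [hτ, Real.pi_ne_zero]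
      simp only [hμ, div_eq_mul_inv]
      exact h1.contDiffAt.mul (h2.contDiffAt.inv h3)
  have hμ2 : HasCompactSupport μ := by
    refine HasCompactSupport.intro
      (isCompact_Icc (a := -(2 * 2 ^ m : ℝ)) (b := 2 * 2 ^ m)) fun x hx => ?_
    rw [Set.mem_Icc, ← abs_le, not_le] at hx
    exact hμ0 x (hψ.psiDy_eq_zero_of_ge hL0 hx.le)
  have hμ3 := hasTemperateGrowth_of_compactSupport hμ1 hμ2
  have hfh := fourier_multiplier_apply hμ3 g
  set h := SchwartzMap.fourierMultiplierCLM ℂ μ g with hh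
  have hd : SchwartzMap.derivCLM ℂ ℂ h = dyadicPiece ψ m g := by
    refine schwartz_ext_fourier fun τ => ?_
    rw [schwartz_fourier_deriv, fourier_dyadicPiece hψ, hfh, ← mul_assoc]
    congr 1
    rcases eq_or_ne τ 0 with rfl | hτ
    · rw [hψ.psiDy_eq_zero_of_le hL (by simp [hL0.le])]
      simp
    · refine mul_div_cancel₀ _ ?_
      simp [hτ, Real.pi_ne_zero]
  refine ⟨h, hd, ?_, ?_⟩
  · refine l2Norm_le_of_fourier fun τ => ?_
    rw [← hd, schwartz_fourier_deriv, norm_mul, ← mul_assoc]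
    rcases le_or_gt (2 * |τ|) (2 ^ m) with hτ | hτ
    · rw [hfh, hμ0 τ (hψ.psiDy_eq_zero_of_le hL hτ), zero_mul, norm_zero, mul_zero]
    · refine le_mul_of_one_le_left (norm_nonneg _) ?_
      rw [le_inv_mul_iff₀ hL0, mul_one]
      simp only [norm_mul, Complex.norm_ofNat, Complex.norm_real, Complex.norm_I,
        Real.norm_eq_abs, abs_of_pos Real.pi_pos, mul_one]
      nlinarith [Real.pi_gt_three]
  · refine schwartz_bernstein (fun τ hτ => ?_) 0
    rw [hfh, hμ0 τ (hψ.psiDy_eq_zero_of_ge hL0 hτ.le), zero_mul]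

lemma sqrt_four_mul_two_pow (m : ℕ) : √(2 * (2 * 2 ^ m)) = 2 * √2 ^ m := by
  rw [sqrt_two_pow_eq, ← mul_assoc, Real.sqrt_mul (by norm_num),
    show (2 : ℝ) * 2 = 2 ^ 2 by norm_num, Real.sqrt_sq zero_le_two]

lemma Bnorm1_duhamel_dyadicPiece_low (hψ : IsCutoff ψ B) (hT : 0 < T) (hT1 : T ≤ 1) (m : ℕ)
    (g : 𝓢(ℝ, ℂ)) : Bnorm1 ψ (1 / 2) (duhamel ψ T (dyadicPiece ψ m g)) ≤
      ENNReal.ofReal (besovConst B * B * (26 * (T * √2 ^ m * l2Norm (dyadicPiece ψ m g)))) := by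
  refine (Bnorm1_duhamel_le_of_bounded hψ hT hT1 (schwartz_bernstein (R := 2 * 2 ^ m)
    fun τ hτ => ?_)).trans_eq ?_
  · rw [fourier_dyadicPiece hψ, hψ.psiDy_eq_zero_of_ge (by positivity) hτ.le,
      Complex.ofReal_zero, zero_mul]
  · rw [sqrt_four_mul_two_pow]
    congr 1
    ring

lemma Bnorm1_duhamel_dyadicPiece_high (hψ : IsCutoff ψ B) (hT : 0 < T) (hT1 : T ≤ 1) {m : ℕ}
    (hm0 : m ≠ 0) (hm : 1 ≤ 2 ^ m * T) (g : 𝓢(ℝ, ℂ)) :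
    Bnorm1 ψ (1 / 2) (duhamel ψ T (dyadicPiece ψ m g)) ≤
      ENNReal.ofReal (besovConst B * B *
        (26 * ((√2 ^ m)⁻¹ * l2Norm (dyadicPiece ψ m g)))) := by
  have hB := hψ.nonneg
  have hK := besovConst_nonneg hB
  obtain ⟨h, hd, h1, h2⟩ := exists_primitive_dyadicPiece hψ hm0 g
  have h3 := Bnorm1_duhamel_deriv_le hψ hT hT1 hm h
  rw [hd] at h3
  refine h3.trans (ENNReal.ofReal_le_ofReal ?_)
  rw [mul_assoc (besovConst B) B]
  have hP := l2Norm_nonneg (dyadicPiece ψ m g)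
  rw [sqrt_four_mul_two_pow] at h2
  generalize l2Norm (dyadicPiece ψ m g) = P at *
  have h4 : (2 : ℝ) ^ m = √2 ^ m * √2 ^ m := by
    rw [← mul_pow, Real.mul_self_sqrt zero_le_two]
  have h5 : √2 ^ m * l2Norm h ≤ (√2 ^ m)⁻¹ * P := by
    calc √2 ^ m * l2Norm h ≤ √2 ^ m * ((2 ^ m)⁻¹ * P) :=
          mul_le_mul_of_nonneg_left h1 (by positivity)
      _ = (√2 ^ m)⁻¹ * P := by
        rw [h4]
        field_simp
  have h6 : 0 ≤ (√2 ^ m)⁻¹ * P := by positivity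
  refine mul_le_mul_of_nonneg_left (mul_le_mul_of_nonneg_left ?_ hB) hK
  linarith

lemma exists_norm_sub_sum_dyadicPiece_le (hψ : IsCutoff ψ B) (g : 𝓢(ℝ, ℂ)) :
    ∃ D, ∀ n : ℕ, ∀ t, ‖(g - ∑ m ∈ Finset.range (n + 1), dyadicPiece ψ m g) t‖ ≤ D / 2 ^ n := by
  have hB := hψ.nonneg
  refine ⟨(1 + B) * ‖(𝓕 (SchwartzMap.derivCLM ℂ ℂ g)).toLp 1‖, fun n t => ?_⟩
  refine (schwartz_norm_apply_le_fourier _ t).trans ?_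
  rw [mul_div_right_comm]
  apply Lp.norm_le_mul_norm_of_ae_le_mul
  filter_upwards [SchwartzMap.coeFn_toLp (𝓕 (SchwartzMap.derivCLM ℂ ℂ g)) 1,
    SchwartzMap.coeFn_toLp (𝓕 (g - ∑ m ∈ Finset.range (n + 1), dyadicPiece ψ m g)) 1]
    with τ h1 h2
  rw [h1, h2, schwartz_fourier_deriv]
  have h3 : 𝓕 (g - ∑ m ∈ Finset.range (n + 1), dyadicPiece ψ m g) τ =
      ((1 - ψ (τ / 2 ^ n) : ℝ) : ℂ) * 𝓕 g τ := by
    have h4 : 𝓕 (g - ∑ m ∈ Finset.range (n + 1), dyadicPiece ψ m g) =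
        𝓕 g - ∑ m ∈ Finset.range (n + 1), 𝓕 (dyadicPiece ψ m g) := by
      simpa using! map_sub (FourierTransform.fourierCLM ℂ 𝓢(ℝ, ℂ)) g
        (∑ m ∈ Finset.range (n + 1), dyadicPiece ψ m g)
    rw [h4, sub_apply, sum_apply, ← IsCutoff.sum_psiDy ψ n τ]
    simp only [fourier_dyadicPiece hψ]
    rw [← Finset.sum_mul]
    push_cast
    ring
  rw [h3, norm_mul, norm_mul, ← mul_assoc, Complex.norm_real]
  refine mul_le_mul_of_nonneg_right ?_ (norm_nonneg _)
  simp only [norm_mul, Complex.norm_ofNat, Complex.norm_real, Complex.norm_I,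
    Real.norm_eq_abs, abs_of_pos Real.pi_pos, mul_one]
  rcases le_or_gt |τ| (2 ^ n) with hτ | hτ
  · rw [hψ.eq_one _ (by rwa [abs_div, abs_of_pos (by positivity : (0 : ℝ) < 2 ^ n),
      div_le_one (by positivity)]), sub_self, abs_zero]
    positivity
  · have h5 : |1 - ψ (τ / 2 ^ n)| ≤ 1 + B := by
      refine (abs_sub _ _).trans ?_
      rw [abs_one]
      linarith [hψ.bound (τ / 2 ^ n)]
    refine h5.trans ?_
    rw [div_mul_eq_mul_div, le_div_iff₀ (by positivity)]
    refine mul_le_mul_of_nonneg_left ?_ (by positivity)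
    have h6 : |τ| ≤ 2 * π * |τ| :=
      le_mul_of_one_le_left (abs_nonneg _) (by linarith [Real.pi_gt_three])
    linarith

end Duhamel

section Assembly

variable {ψ : ℝ → ℝ} {B T : ℝ}

/-- The twelfth root of two. -/
def twelfthRoot : ℝ := 2 ^ ((1 : ℝ) / 12)

lemma one_lt_twelfthRoot : 1 < twelfthRoot := Real.one_lt_rpow one_lt_two (by norm_num)

lemma twelfthRoot_pow : twelfthRoot ^ 12 = 2 := by
  unfold twelfthRoot
  rw [← Real.rpow_natCast, ← Real.rpow_mul zero_le_two]
  norm_num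

lemma sqrt_two_eq_twelfthRoot_pow : √2 = twelfthRoot ^ 6 := by
  have := one_lt_twelfthRoot
  refine (Real.sqrt_eq_iff_mul_self_eq (by norm_num) (by positivity)).2 ?_
  rw [← pow_add, twelfthRoot_pow]

lemma two_pow_rpow_neg_five_twelfths (m : ℕ) :
    ((2 : ℝ) ^ m) ^ (-(5 / 12) : ℝ) = (twelfthRoot ^ (5 * m))⁻¹ := by
  unfold twelfthRoot
  rw [← Real.rpow_natCast, ← Real.rpow_natCast, ← Real.rpow_mul zero_le_two,
    ← Real.rpow_mul zero_le_two, ← Real.rpow_neg zero_le_two]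
  congr 1
  push_cast
  ring

lemma low_frequency_factor_le (hT : 0 < T) {a m : ℕ} (hma : m ≤ a) (ha : 2 ^ a * T ≤ 1) :
    T * √2 ^ m * twelfthRoot ^ (5 * m) ≤
      (twelfthRoot ^ a)⁻¹ * (twelfthRoot⁻¹ ^ (m - a) * twelfthRoot⁻¹ ^ (a - m)) := by
  have hq := one_lt_twelfthRoot
  rw [← twelfthRoot_pow, ← pow_mul] at ha
  rw [sqrt_two_eq_twelfthRoot_pow]
  generalize twelfthRoot = q at *
  obtain ⟨d, rfl⟩ := Nat.exists_eq_add_of_le hma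
  rw [Nat.sub_eq_zero_of_le hma, Nat.add_sub_cancel_left, pow_zero, one_mul, inv_pow,
    ← mul_inv, ← one_div, le_div_iff₀ (by positivity), ← pow_mul]
  calc T * q ^ (6 * m) * q ^ (5 * m) * (q ^ (m + d) * q ^ d) = q ^ (12 * m + 2 * d) * T := by ring
    _ ≤ q ^ (12 * (m + d)) * T :=
        mul_le_mul_of_nonneg_right (pow_le_pow_right₀ hq.le (by omega)) hT.le
    _ ≤ 1 := ha

lemma high_frequency_factor_eq {a m : ℕ} (hma : a ≤ m) :
    (√2 ^ m)⁻¹ * twelfthRoot ^ (5 * m) =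
      (twelfthRoot ^ a)⁻¹ * (twelfthRoot⁻¹ ^ (m - a) * twelfthRoot⁻¹ ^ (a - m)) := by
  have hq := one_lt_twelfthRoot
  rw [sqrt_two_eq_twelfthRoot_pow]
  generalize twelfthRoot = q at *
  obtain ⟨d, rfl⟩ := Nat.exists_eq_add_of_le hma
  rw [Nat.sub_eq_zero_of_le hma, Nat.add_sub_cancel_left, pow_zero, mul_one, inv_pow]
  field_simp
  ring

lemma inv_twelfthRoot_pow_le (hT : 0 < T) {a : ℕ} (ha : 1 < 2 ^ (a + 1) * T) :
    (twelfthRoot ^ a)⁻¹ ≤ twelfthRoot * T ^ ((1 : ℝ) / 12) := by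
  have hq := one_lt_twelfthRoot
  have hT12 : (T ^ ((1 : ℝ) / 12)) ^ 12 = T := by
    rw [← Real.rpow_natCast, ← Real.rpow_mul hT.le]
    norm_num
  rw [← one_div, div_le_iff₀ (by positivity)]
  refine (one_le_pow_iff_of_nonneg (by positivity) (by norm_num : 12 ≠ 0)).1 (ha.le.trans_eq ?_)
  rw [mul_pow, mul_pow, hT12, ← pow_mul, mul_comm a 12, pow_mul, twelfthRoot_pow]
  ring

lemma l2Norm_dyadicPiece_le (hψ : IsCutoff ψ B) {g : 𝓢(ℝ, ℂ)}
    (hg : BnormSup ψ (-(5 / 12)) g ≠ ∞) (m : ℕ) :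
    l2Norm (dyadicPiece ψ m g) ≤
      twelfthRoot ^ (5 * m) * (BnormSup ψ (-(5 / 12)) g).toReal := by
  have hq := one_lt_twelfthRoot
  have h1 : ENNReal.ofReal (((2 : ℝ) ^ m) ^ (-(5 / 12) : ℝ)) *
      eLpNorm (PL ψ ((2 : ℝ) ^ m) g) 2 volume ≤ BnormSup ψ (-(5 / 12)) g :=
    le_iSup (fun l : ℕ => ENNReal.ofReal (((2 : ℝ) ^ l) ^ (-(5 / 12) : ℝ)) *
      eLpNorm (PL ψ ((2 : ℝ) ^ l) g) 2 volume) m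
  rw [coe_dyadicPiece hψ, schwartz_eLpNorm_eq, two_pow_rpow_neg_five_twelfths,
    ← ENNReal.ofReal_mul (by positivity), ENNReal.ofReal_le_iff_le_toReal hg,
    inv_mul_le_iff₀ (by positivity)] at h1
  exact h1

lemma Bnorm1_duhamel_dyadicPiece_le (hψ : IsCutoff ψ B) (hT : 0 < T) (hT1 : T ≤ 1) {a : ℕ}
    (ha1 : 2 ^ a * T ≤ 1) (ha2 : 1 < 2 ^ (a + 1) * T) {g : 𝓢(ℝ, ℂ)}
    (hg : BnormSup ψ (-(5 / 12)) g ≠ ∞) (m : ℕ) :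
    Bnorm1 ψ (1 / 2) (duhamel ψ T (dyadicPiece ψ m g)) ≤
      ENNReal.ofReal (besovConst B * B * (26 * ((twelfthRoot ^ a)⁻¹ *
        (twelfthRoot⁻¹ ^ (m - a) * twelfthRoot⁻¹ ^ (a - m)) *
          (BnormSup ψ (-(5 / 12)) g).toReal))) := by
  have hB := hψ.nonneg
  have hK := besovConst_nonneg hB
  have hN : 0 ≤ (BnormSup ψ (-(5 / 12)) g).toReal := ENNReal.toReal_nonneg
  have h1 := l2Norm_dyadicPiece_le hψ hg m
  rcases le_or_gt m a with hma | hma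
  · refine (Bnorm1_duhamel_dyadicPiece_low hψ hT hT1 m g).trans (ENNReal.ofReal_le_ofReal ?_)
    refine mul_le_mul_of_nonneg_left (mul_le_mul_of_nonneg_left ?_ (by norm_num)) (by positivity)
    refine (mul_le_mul_of_nonneg_left h1 (by positivity)).trans ?_
    rw [← mul_assoc]
    exact mul_le_mul_of_nonneg_right (low_frequency_factor_le hT hma ha1) hN
  · have hm : 1 ≤ 2 ^ m * T := ha2.le.trans
      (mul_le_mul_of_nonneg_right (pow_le_pow_right₀ one_le_two hma) hT.le)
    refine (Bnorm1_duhamel_dyadicPiece_high hψ hT hT1 (Nat.ne_zero_of_lt hma) hm g).trans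
      (ENNReal.ofReal_le_ofReal ?_)
    refine mul_le_mul_of_nonneg_left (mul_le_mul_of_nonneg_left ?_ (by norm_num)) (by positivity)
    refine (mul_le_mul_of_nonneg_left h1 (by positivity)).trans_eq ?_
    rw [← mul_assoc, high_frequency_factor_eq hma.le]

/-- The constant in `Bnorm1_duhamel_le`. -/
def duhamelConst (B : ℝ) : ℝ :=
  26 * (besovConst B * B) * (2 / (1 - twelfthRoot⁻¹)) * twelfthRoot

lemma duhamelConst_nonneg (hB : 0 ≤ B) : 0 ≤ duhamelConst B := by
  have hK := besovConst_nonneg hB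
  have hq := one_lt_twelfthRoot
  have h : 0 < 1 - twelfthRoot⁻¹ := by linarith [inv_lt_one_of_one_lt₀ hq]
  unfold duhamelConst
  positivity

lemma sum_Bnorm1_duhamel_dyadicPiece_le (hψ : IsCutoff ψ B) (hT : 0 < T) (hT1 : T ≤ 1)
    {g : 𝓢(ℝ, ℂ)} (hg : BnormSup ψ (-(5 / 12)) g ≠ ∞) (n : ℕ) :
    ∑ m ∈ Finset.range n, Bnorm1 ψ (1 / 2) (duhamel ψ T (dyadicPiece ψ m g)) ≤
      ENNReal.ofReal (duhamelConst B * T ^ ((1 : ℝ) / 12) *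
        (BnormSup ψ (-(5 / 12)) g).toReal) := by
  obtain ⟨a, ha1, ha2⟩ := exists_dyadic_scale hT hT1
  have hB := hψ.nonneg
  have hK := besovConst_nonneg hB
  have hq := one_lt_twelfthRoot
  have hr := inv_lt_one_of_one_lt₀ hq
  have h1 := sum_geometric_dist_le (r := twelfthRoot⁻¹) (by positivity) hr a n
  have h2 := inv_twelfthRoot_pow_le hT ha2
  refine (Finset.sum_le_sum fun m _ =>
    Bnorm1_duhamel_dyadicPiece_le hψ hT hT1 ha1 ha2 hg m).trans ?_
  have hN : 0 ≤ (BnormSup ψ (-(5 / 12)) g).toReal := ENNReal.toReal_nonneg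
  unfold duhamelConst
  generalize (BnormSup ψ (-(5 / 12)) g).toReal = N at *
  generalize besovConst B = K at *
  generalize twelfthRoot = q at *
  rw [← ENNReal.ofReal_sum_of_nonneg fun m _ => by positivity]
  refine ENNReal.ofReal_le_ofReal ?_
  rw [← Finset.mul_sum, ← Finset.mul_sum, ← Finset.sum_mul, ← Finset.mul_sum]
  calc K * B * (26 * ((q ^ a)⁻¹ * (∑ m ∈ Finset.range n, q⁻¹ ^ (m - a) * q⁻¹ ^ (a - m)) * N))
      ≤ K * B * (26 * (q * T ^ ((1 : ℝ) / 12) * (2 / (1 - q⁻¹)) * N)) := by gcongr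
    _ = _ := by ring

lemma Bnorm1_duhamel_le (hψ : IsCutoff ψ B) (hT : 0 < T) (hT1 : T ≤ 1) {g : 𝓢(ℝ, ℂ)}
    (hg : BnormSup ψ (-(5 / 12)) g ≠ ∞) :
    Bnorm1 ψ (1 / 2) (duhamel ψ T g) ≤ ENNReal.ofReal
      (duhamelConst B * T ^ ((1 : ℝ) / 12) * (BnormSup ψ (-(5 / 12)) g).toReal) := by
  obtain ⟨D, hD⟩ := exists_norm_sub_sum_dyadicPiece_le hψ g
  have hlim : Filter.Tendsto
      (fun n : ℕ => ENNReal.ofReal (besovConst B * (B * (13 * T * (D / 2 ^ n)))))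
      Filter.atTop (nhds 0) := by
    have h1 : Filter.Tendsto (fun n : ℕ => D / (2 : ℝ) ^ n) Filter.atTop (nhds 0) :=
      tendsto_const_nhds.div_atTop (tendsto_pow_atTop_atTop_of_one_lt one_lt_two)
    have h2 := ((h1.const_mul (13 * T)).const_mul B).const_mul (besovConst B)
    simpa using! ENNReal.tendsto_ofReal h2
  have h3 := hlim.const_add (ENNReal.ofReal
    (duhamelConst B * T ^ ((1 : ℝ) / 12) * (BnormSup ψ (-(5 / 12)) g).toReal))
  rw [add_zero] at h3
  refine ge_of_tendsto' h3 fun n => ?_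
  exact (Bnorm1_duhamel_le_sum_add hψ hT g (fun m => dyadicPiece ψ m g) (n + 1)).trans
    (add_le_add (sum_Bnorm1_duhamel_dyadicPiece_le hψ hT hT1 hg _)
      (Bnorm1_duhamel_le_of_bounded hψ hT hT1 (hD n)))

end Assembly

/-- Localized Duhamel estimate in Besov spaces:
‖ψ_T·𝓘(g)‖_{B^{1/2}_{2,1}} ≲ T^{1/12} ‖g‖_{B^{−5/12}_{2,∞}}, where 𝓘(g)(t) = ∫₀ᵗ g. -/
theorem besov_duhamel (ψ : ℝ → ℝ) (hψsmooth : ContDiff ℝ (⊤ : ℕ∞) ψ)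
    (hψeven : ∀ r, ψ (-r) = ψ r) (hψnonneg : ∀ r, 0 ≤ ψ r)
    (hψsupp : Function.support ψ ⊆ Set.Ioo (-2) 2)
    (hψone : ∀ r ∈ Set.Icc (-1 : ℝ) 1, ψ r = 1) :
    ∃ C : ℝ, 0 < C ∧
      ∀ T : ℝ, 0 < T → T ≤ 1 → ∀ g : SchwartzMap ℝ ℂ,
        Bnorm1 ψ (1 / 2) (fun t => (ψ (t / T) : ℂ) * ∫ t' in (0 : ℝ)..t, g t') ≤
          ENNReal.ofReal (C * T ^ ((1 : ℝ) / 12)) * BnormSup ψ (-(5 / 12)) ⇑g := by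
  have h0 : ∀ r, 2 ≤ |r| → ψ r = 0 := fun r hr => by
    by_contra h
    exact absurd (abs_lt.2 (hψsupp h)) (not_lt.2 hr)
  obtain ⟨B, hψ⟩ := IsCutoff.exists_bound hψsmooth h0 fun r hr => hψone r (abs_le.1 hr)
  have hC := duhamelConst_nonneg hψ.nonneg
  refine ⟨duhamelConst B + 1, by positivity, fun T hT hT1 g => ?_⟩
  have hT12 : 0 < T ^ ((1 : ℝ) / 12) := Real.rpow_pos_of_pos hT _
  rcases eq_or_ne (BnormSup ψ (-(5 / 12)) g) ∞ with hg | hg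
  · rw [hg, ENNReal.mul_top (ENNReal.ofReal_pos.2 (by positivity)).ne']
    exact le_top
  · refine (Bnorm1_duhamel_le hψ hT hT1 hg).trans ?_
    rw [ENNReal.ofReal_mul (by positivity), ENNReal.ofReal_toReal hg]
    gcongr
    linarith
end
end

section
/- (Failure of the Schrödinger bilinear estimate below the threshold.) Let k,ℓ ∈ ℝ and b',b₁,b₂ ∈ ℝ. Suppose either (i) ℓ < −1/2, or (ii) ℓ = −1/2, b',b₁,b₂ ≥ 0 and b'+b₁+b₂ < 5/4. Then there is no constant C such that ‖u v‖_{X^S_{k,−b'}} ≤ C ‖v‖_{X^{W+}_{ℓ,b₁}} ‖u‖_{X^S_{k,b₂}} holds for all Schwartz functions u,v on ℝ²×ℝ. -/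
noncomputable section

open MeasureTheory Real
open scoped FourierTransform ENNReal

/-- Space-time ℝ²×ℝ, modeled as ℝ³; the first two coordinates are the spatial
frequency ξ and the last one is the time frequency τ. -/
abbrev SpaceTime : Type := EuclideanSpace ℝ (Fin 3)

/-- |ξ|, the norm of the spatial frequency. -/
def spFreq (ζ : SpaceTime) : ℝ := Real.sqrt (ζ 0 ^ 2 + ζ 1 ^ 2)

/-- τ, the time frequency. -/
def tFreq (ζ : SpaceTime) : ℝ := ζ 2

/-- The Japanese bracket ⟨x⟩ = (1+x²)^{1/2}. -/
def jap (r : ℝ) : ℝ := Real.sqrt (1 + r ^ 2)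

/-- The Schrödinger weight ⟨ξ⟩^k ⟨τ+|ξ|²⟩^b. -/
def wS (k b : ℝ) (ζ : SpaceTime) : ℝ :=
  jap (spFreq ζ) ^ k * jap (tFreq ζ + spFreq ζ ^ 2) ^ b

/-- The wave weight ⟨ξ⟩^ℓ ⟨τ+|ξ|⟩^b. -/
def wW (l b : ℝ) (ζ : SpaceTime) : ℝ :=
  jap (spFreq ζ) ^ l * jap (tFreq ζ + spFreq ζ) ^ b

/-- The norm ‖u‖_{X^S_{k,b}} = ‖⟨ξ⟩^k ⟨τ+|ξ|²⟩^b 𝔉u‖_{L²(ℝ²×ℝ)}. -/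
def XSn (k b : ℝ) (u : SpaceTime → ℂ) : ℝ≥0∞ :=
  eLpNorm (fun ζ => (wS k b ζ : ℂ) * 𝓕 u ζ) 2 volume

/-- The norm ‖v‖_{X^{W+}_{ℓ,b}} = ‖⟨ξ⟩^ℓ ⟨τ+|ξ|⟩^b 𝔉v‖_{L²(ℝ²×ℝ)}. -/
def XWn (l b : ℝ) (v : SpaceTime → ℂ) : ℝ≥0∞ :=
  eLpNorm (fun ζ => (wW l b ζ : ℂ) * 𝓕 v ζ) 2 volume

open Convolution

/-- The closed box with center `c` and half-widths `r`. -/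
def box (c r : Fin 3 → ℝ) : Set SpaceTime := {ζ | ∀ i, |ζ i - c i| ≤ r i}

theorem box_eq_preimage (c r : Fin 3 → ℝ) :
    box c r = WithLp.ofLp ⁻¹' Set.Icc (c - r) (c + r) := by
  ext ζ
  simp only [box, Set.mem_ofPred_eq, Set.mem_preimage, Set.mem_Icc, Pi.le_def, ← forall_and,
    Pi.sub_apply, Pi.add_apply, abs_sub_le_iff]
  exact forall_congr' fun i =>
    ⟨fun h => ⟨by linarith, by linarith⟩, fun h => ⟨by linarith, by linarith⟩⟩

theorem isCompact_box (c r : Fin 3 → ℝ) : IsCompact (box c r) := by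
  rw [box_eq_preimage]
  exact (EuclideanSpace.equiv (Fin 3) ℝ).toHomeomorph.isCompact_preimage.2 isCompact_Icc

theorem measurableSet_box (c r : Fin 3 → ℝ) : MeasurableSet (box c r) :=
  (isCompact_box c r).measurableSet

theorem volume_box (c r : Fin 3 → ℝ) (hr : ∀ i, 0 ≤ r i) :
    volume (box c r) = ENNReal.ofReal (∏ i, 2 * r i) := by
  rw [box_eq_preimage, (PiLp.volume_preserving_ofLp (Fin 3)).measure_preimage
    measurableSet_Icc.nullMeasurableSet, Real.volume_Icc_pi,
    ENNReal.ofReal_prod_of_nonneg fun i _ => mul_nonneg zero_le_two (hr i)]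
  refine Finset.prod_congr rfl fun i _ => ?_
  congr 1
  simp only [Pi.sub_apply, Pi.add_apply]
  ring

theorem exists_schwartz_bump (c r : Fin 3 → ℝ) (hr : ∀ i, 0 < r i) :
    ∃ (φ : SchwartzMap SpaceTime ℂ) (f : SpaceTime → ℝ), (∀ ζ, φ ζ = f ζ) ∧
      (∀ ζ, 0 ≤ f ζ) ∧ (∀ ζ, f ζ ≤ 1) ∧ (∀ ζ ∈ box c r, f ζ = 1) ∧
      ∀ ζ ∉ box c ((2 : ℝ) • r), f ζ = 0 := by
  let g : ContDiffBump (0 : ℝ) := ⟨1, 2, one_pos, one_lt_two⟩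
  let f : SpaceTime → ℝ := fun ζ => ∏ i, g ((ζ i - c i) / r i)
  have hf : ContDiff ℝ (⊤ : ℕ∞) f := by
    refine contDiff_prod fun i _ => g.contDiff.comp ?_
    fun_prop
  have h_zero : ∀ ζ ∉ box c ((2 : ℝ) • r), f ζ = 0 := by
    intro ζ h
    simp only [box, Set.mem_ofPred_eq, not_forall, not_le] at h
    obtain ⟨i, hi⟩ := h
    refine Finset.prod_eq_zero (Finset.mem_univ i) (g.zero_of_le_dist ?_)
    rw [dist_zero_right, Real.norm_eq_abs, abs_div, abs_of_pos (hr i), le_div_iff₀ (hr i)]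
    simpa using hi.le
  have hs : HasCompactSupport fun ζ => (f ζ : ℂ) :=
    HasCompactSupport.intro (isCompact_box c ((2 : ℝ) • r)) fun ζ h => by simp [h_zero ζ h]
  refine ⟨hs.toSchwartzMap (Complex.ofRealCLM.contDiff.comp hf), f, fun ζ => rfl,
    fun ζ => Finset.prod_nonneg fun i _ => g.nonneg,
    fun ζ => Finset.prod_le_one (fun i _ => g.nonneg) fun i _ => g.le_one,
    fun ζ h => Finset.prod_eq_one fun i _ => g.one_of_mem_closedBall ?_, h_zero⟩
  rw [mem_closedBall_zero_iff, Real.norm_eq_abs, abs_div, abs_of_pos (hr i),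
    div_le_one (hr i)]
  exact h i

theorem fourier_mul_fourierInv (φ ψ : SchwartzMap SpaceTime ℂ) :
    𝓕 (fun x => 𝓕⁻ φ x * 𝓕⁻ ψ x) = φ ⋆[ContinuousLinearMap.mul ℂ ℂ] ψ := by
  set χ := SchwartzMap.convolution (ContinuousLinearMap.mul ℂ ℂ) φ ψ
  have h : (fun x => 𝓕⁻ φ x * 𝓕⁻ ψ x) = ⇑(𝓕⁻ χ : SchwartzMap SpaceTime ℂ) := by
    funext x
    have := SchwartzMap.fourier_convolution_apply (ContinuousLinearMap.mul ℂ ℂ) φ ψ (-x)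
    rw [Real.fourier_mul_convolution_eq φ.integrable ψ.integrable] at this
    simp only [SchwartzMap.fourierInv_coe, SchwartzMap.fourier_coe,
      Real.fourierInv_eq_fourier_neg] at this ⊢
    exact this.symm
  rw [h, ← SchwartzMap.fourier_coe, FourierTransform.fourier_fourierInv_eq]
  funext x
  exact SchwartzMap.convolution_apply _ φ ψ x

theorem exists_schwartz_pair (c₁ c₂ r : Fin 3 → ℝ) (hr : ∀ i, 0 < r i) :
    ∃ u v : SchwartzMap SpaceTime ℂ,
      (∀ ζ, ‖𝓕 ⇑u ζ‖ ≤ (box c₁ ((2 : ℝ) • r)).indicator 1 ζ) ∧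
      (∀ ζ, ‖𝓕 ⇑v ζ‖ ≤ (box c₂ ((2 : ℝ) • r)).indicator 1 ζ) ∧
      ∀ ζ ∈ box (c₁ + c₂) ((1 / 2 : ℝ) • r), ∏ i, r i ≤ ‖𝓕 (fun x => u x * v x) ζ‖ := by
  obtain ⟨φ, f, hφ, f0, f1, fK, fU⟩ := exists_schwartz_bump c₁ r hr
  obtain ⟨ψ, g, hψ, g0, g1, gK, gU⟩ := exists_schwartz_bump c₂ r hr
  have bound : ∀ (χ : SchwartzMap SpaceTime ℂ) (h : SpaceTime → ℝ) (c : Fin 3 → ℝ),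
      (∀ ζ, χ ζ = h ζ) → (∀ ζ, 0 ≤ h ζ) → (∀ ζ, h ζ ≤ 1) → (∀ ζ ∉ box c ((2 : ℝ) • r), h ζ = 0) →
      ∀ ζ, ‖𝓕 ⇑(𝓕⁻ χ : SchwartzMap SpaceTime ℂ) ζ‖ ≤ (box c ((2 : ℝ) • r)).indicator 1 ζ := by
    intro χ h c hχ h0 h1 hU ζ
    rw [← SchwartzMap.fourier_coe, FourierTransform.fourier_fourierInv_eq, hχ]
    by_cases hζ : ζ ∈ box c ((2 : ℝ) • r)
    · simpa [hζ, abs_of_nonneg (h0 ζ)] using h1 ζ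
    · simp [hζ, hU ζ hζ]
  refine ⟨𝓕⁻ φ, 𝓕⁻ ψ, bound φ f c₁ hφ f0 f1 fU, bound ψ g c₂ hψ g0 g1 gU, fun ζ hζ => ?_⟩
  rw [fourier_mul_fourierInv, convolution_def]
  have hint : Integrable fun t => f t * g (ζ - t) := by
    have hc : ∀ (χ : SchwartzMap SpaceTime ℂ) (h : SpaceTime → ℝ), (∀ ζ, χ ζ = h ζ) →
        h = fun ζ => (χ ζ).re := fun χ h hχ => by simp [hχ]
    refine Integrable.mul_bdd (c := 1) ?_ ?_ (.of_forall fun t => ?_)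
    · rw [hc φ f hφ]
      exact φ.integrable.re
    · rw [hc ψ g hψ]
      exact (Complex.continuous_re.comp
        (ψ.continuous.comp (continuous_const.sub continuous_id))).aestronglyMeasurable
    · simpa [abs_of_nonneg (g0 _)] using g1 (ζ - t)
  have e : (∫ t, ContinuousLinearMap.mul ℂ ℂ (φ t) (ψ (ζ - t))) =
      ((∫ t, f t * g (ζ - t) : ℝ) : ℂ) := by
    rw [← integral_complex_ofReal]
    simp [hφ, hψ]
  rw [e, Complex.norm_real]
  refine le_trans ?_ (le_abs_self _)
  set P := box c₁ ((1 / 2 : ℝ) • r)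
  have hP : volume P = ENNReal.ofReal (∏ i, r i) := by
    rw [volume_box _ _ fun i => by simpa using (hr i).le]
    simp
  have hPt : ∀ t ∈ P, f t * g (ζ - t) = 1 := by
    intro t ht
    rw [fK t fun i => ?_, gK (ζ - t) fun i => ?_, one_mul]
    · have h1 := abs_le.1 (ht i)
      have h2 := abs_le.1 (hζ i)
      simp only [Pi.smul_apply, smul_eq_mul, Pi.add_apply, PiLp.sub_apply] at *
      rw [abs_le]
      constructor <;> linarith [h1.1, h1.2, h2.1, h2.2]
    · have h1 := ht i
      simp only [Pi.smul_apply, smul_eq_mul] at h1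
      linarith [hr i]
  calc ∏ i, r i = ∫ t in P, f t * g (ζ - t) := by
        rw [setIntegral_congr_fun (measurableSet_box _ _) (g := fun _ => (1 : ℝ)) hPt]
        rw [setIntegral_const, Measure.real, hP,
          ENNReal.toReal_ofReal (Finset.prod_nonneg fun i _ => (hr i).le), smul_eq_mul, mul_one]
    _ ≤ _ := setIntegral_le_integral hint (.of_forall fun t => mul_nonneg (f0 _) (g0 _))

theorem eLpNorm_two_le_of_box {f : SpaceTime → ℂ} {c r : Fin 3 → ℝ} {M : ℝ} (hr : ∀ i, 0 ≤ r i)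
    (hM : 0 ≤ M) (hf : ∀ ζ, ‖f ζ‖ ≤ (box c r).indicator (fun _ => M) ζ) :
    eLpNorm f 2 volume ≤ ENNReal.ofReal (M * √(∏ i, 2 * r i)) := by
  refine (eLpNorm_mono_real hf).trans ?_
  rw [eLpNorm_indicator_const (measurableSet_box c r) two_ne_zero ENNReal.ofNat_ne_top,
    volume_box c r hr, ENNReal.ofReal_rpow_of_nonneg
      (Finset.prod_nonneg fun i _ => mul_nonneg zero_le_two (hr i)) (by positivity),
    Real.enorm_of_nonneg hM, ← ENNReal.ofReal_mul hM, Real.sqrt_eq_rpow]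
  simp

theorem le_eLpNorm_two_of_box {f : SpaceTime → ℂ} {c r : Fin 3 → ℝ} {M : ℝ} (hr : ∀ i, 0 ≤ r i)
    (hM : 0 ≤ M) (hf : ∀ ζ ∈ box c r, M ≤ ‖f ζ‖) :
    ENNReal.ofReal (M * √(∏ i, 2 * r i)) ≤ eLpNorm f 2 volume := by
  have h : eLpNorm ((box c r).indicator fun _ => M) 2 volume ≤ eLpNorm f 2 volume := by
    refine eLpNorm_mono fun ζ => ?_
    by_cases hζ : ζ ∈ box c r
    · simpa [hζ, abs_of_nonneg hM] using hf ζ hζ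
    · simp [hζ]
  rw [eLpNorm_indicator_const (measurableSet_box c r) two_ne_zero ENNReal.ofNat_ne_top,
    volume_box c r hr, ENNReal.ofReal_rpow_of_nonneg
      (Finset.prod_nonneg fun i _ => mul_nonneg zero_le_two (hr i)) (by positivity),
    Real.enorm_of_nonneg hM, ← ENNReal.ofReal_mul hM] at h
  rw [Real.sqrt_eq_rpow]
  simpa using h

theorem rpow_le_rpow_abs_mul_rpow {x y D : ℝ} (k : ℝ) (hx : 0 < x) (hy : 0 < y)
    (hxy : x ≤ D * y) (hyx : y ≤ D * x) : x ^ k ≤ D ^ |k| * y ^ k := by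
  have h : (x / y) ^ k ≤ D ^ |k| := by
    rcases le_total 0 k with hk | hk
    · rw [abs_of_nonneg hk]
      exact Real.rpow_le_rpow (by positivity) ((div_le_iff₀ hy).2 hxy) hk
    · rw [abs_of_nonpos hk, ← inv_div, Real.inv_rpow (by positivity),
        ← Real.rpow_neg (by positivity)]
      exact Real.rpow_le_rpow (by positivity) ((div_le_iff₀ hx).2 hyx) (neg_nonneg.2 hk)
  rwa [Real.div_rpow hx.le hy.le, div_le_iff₀ (Real.rpow_pos_of_pos hy k)] at h

theorem one_le_jap (x : ℝ) : 1 ≤ jap x := by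
  rw [jap, Real.one_le_sqrt]
  nlinarith [sq_nonneg x]

theorem jap_le_one_add_abs (x : ℝ) : jap x ≤ 1 + |x| := by
  rw [jap, Real.sqrt_le_left (by positivity)]
  nlinarith [sq_abs x, abs_nonneg x]

theorem abs_le_jap (x : ℝ) : |x| ≤ jap x := by
  rw [jap]
  refine Real.abs_le_sqrt ?_
  linarith

theorem weight_bounds {N M D s m : ℝ} (k b : ℝ) (hN : 0 < N)
    (h₁ : jap s ≤ D * N) (h₂ : N ≤ D * jap s) (hm : jap m ≤ M) :
    jap s ^ k * jap m ^ b ≤ D ^ |k| * N ^ k * M ^ |b| ∧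
      N ^ k ≤ D ^ |k| * M ^ |b| * (jap s ^ k * jap m ^ b) := by
  have hs : 0 < jap s := one_pos.trans_le (one_le_jap s)
  have hm0 : 0 < jap m := one_pos.trans_le (one_le_jap m)
  have hM : 1 ≤ M := (one_le_jap m).trans hm
  have hm1 : 1 ≤ M * jap m := one_le_mul_of_one_le_of_one_le hM (one_le_jap m)
  have e₁ := rpow_le_rpow_abs_mul_rpow k hs hN h₁ h₂
  have e₂ := rpow_le_rpow_abs_mul_rpow k hN hs h₂ h₁
  have e₃ := rpow_le_rpow_abs_mul_rpow b hm0 one_pos (by linarith) hm1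
  have e₄ := rpow_le_rpow_abs_mul_rpow b one_pos hm0 hm1 (by linarith)
  rw [Real.one_rpow, mul_one] at e₃
  rw [Real.one_rpow] at e₄
  constructor
  · exact mul_le_mul e₁ e₃ (by positivity) (le_trans (by positivity) e₁)
  · calc N ^ k = N ^ k * 1 := (mul_one _).symm
      _ ≤ (D ^ |k| * jap s ^ k) * (M ^ |b| * jap m ^ b) :=
        mul_le_mul e₂ e₄ zero_le_one (le_trans (by positivity) e₂)
      _ = _ := by ring

theorem spFreq_sq (ζ : SpaceTime) : spFreq ζ ^ 2 = ζ 0 ^ 2 + ζ 1 ^ 2 :=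
  Real.sq_sqrt (by positivity)

/-- The half-widths of a box adapted to frequency `N` and modulation `L`. -/
def radii (N L : ℝ) : Fin 3 → ℝ := ![L / N, √L, L]

theorem coord_bounds {N L a τ : ℝ} {ζ : SpaceTime} (hN : 16 ≤ N) (hL : 1 ≤ L) (hLN : L ≤ N)
    (hζ : ζ ∈ box ![a, 0, τ] ((2 : ℝ) • radii N L)) :
    |ζ 0 - a| * N ≤ 2 * L ∧ |ζ 0 - a| ≤ 2 ∧ ζ 1 ^ 2 ≤ 4 * L ∧ |ζ 2 - τ| ≤ 2 * L := by
  have h₀ := hζ 0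
  have h₁ := hζ 1
  have h₂ := hζ 2
  simp [radii] at h₀ h₁ h₂
  have hN0 : 0 < N := by linarith
  have h₃ : L / N ≤ 1 := (div_le_one hN0).2 hLN
  refine ⟨?_, by linarith, ?_, h₂⟩
  · calc |ζ 0 - a| * N ≤ 2 * (L / N) * N := by gcongr
      _ = 2 * L := by field_simp
  · have := Real.sq_sqrt (zero_le_one.trans hL)
    rw [← sq_abs]
    nlinarith [abs_nonneg (ζ 1), Real.sqrt_nonneg L]

theorem jap_spFreq_bounds {N L a τ : ℝ} {ζ : SpaceTime} (hN : 16 ≤ N) (hL : 1 ≤ L) (hLN : L ≤ N)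
    (ha : (N - 1) / 2 ≤ |a|) (ha' : |a| ≤ N)
    (hζ : ζ ∈ box ![a, 0, τ] ((2 : ℝ) • radii N L)) :
    jap (spFreq ζ) ≤ 16 * N ∧ N ≤ 16 * jap (spFreq ζ) := by
  obtain ⟨-, hx, hy, -⟩ := coord_bounds hN hL hLN hζ
  have h₁ : |ζ 0| ≤ N + 2 := by
    have := abs_sub_abs_le_abs_sub (ζ 0) a
    linarith
  have h₂ : (N - 1) / 2 - 2 ≤ |ζ 0| := by
    have := abs_sub_abs_le_abs_sub a (ζ 0)
    rw [abs_sub_comm] at this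
    linarith
  have h₃ : |ζ 0| ≤ spFreq ζ := Real.abs_le_sqrt (by nlinarith [sq_nonneg (ζ 1)])
  constructor
  · rw [jap, spFreq_sq, Real.sqrt_le_left (by linarith)]
    nlinarith [sq_abs (ζ 0), abs_nonneg (ζ 0)]
  · have := (le_abs_self _).trans (abs_le_jap (spFreq ζ))
    linarith

theorem jap_schrodinger_modulation_le {N L a : ℝ} {ζ : SpaceTime} (hN : 16 ≤ N) (hL : 1 ≤ L)
    (hLN : L ≤ N) (ha : |a| ≤ (N + 1) / 2)
    (hζ : ζ ∈ box ![a, 0, -a ^ 2] ((2 : ℝ) • radii N L)) :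
    jap (tFreq ζ + spFreq ζ ^ 2) ≤ 16 * L := by
  obtain ⟨hxN, hx, hy, ht⟩ := coord_bounds hN hL hLN hζ
  refine (jap_le_one_add_abs _).trans ?_
  have h₁ : |(ζ 0 - a) * (2 * a + (ζ 0 - a))| ≤ 4 * L := by
    have : |2 * a + (ζ 0 - a)| ≤ 2 * N := by
      refine (abs_add_le _ _).trans ?_
      rw [abs_mul, abs_two]
      linarith
    rw [abs_mul]
    nlinarith [abs_nonneg (ζ 0 - a)]
  have h₂ : |tFreq ζ + spFreq ζ ^ 2| ≤ 10 * L := by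
    rw [spFreq_sq, tFreq, show ζ 2 + (ζ 0 ^ 2 + ζ 1 ^ 2) =
      (ζ 2 - -a ^ 2) + (ζ 0 - a) * (2 * a + (ζ 0 - a)) + ζ 1 ^ 2 by ring]
    refine (abs_add_three _ _ _).trans ?_
    rw [abs_of_nonneg (sq_nonneg (ζ 1))]
    linarith
  linarith

theorem jap_wave_modulation_le {N L : ℝ} {ζ : SpaceTime} (hN : 16 ≤ N) (hL : 1 ≤ L)
    (hLN : L ≤ N) (hζ : ζ ∈ box ![N, 0, -N] ((2 : ℝ) • radii N L)) :
    jap (tFreq ζ + spFreq ζ) ≤ 16 * L := by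
  obtain ⟨-, hx, hy, ht⟩ := coord_bounds hN hL hLN hζ
  refine (jap_le_one_add_abs _).trans ?_
  rw [abs_le] at hx ht
  have h₁ : ζ 0 ≤ spFreq ζ := (le_abs_self _).trans
    (Real.abs_le_sqrt (by nlinarith [sq_nonneg (ζ 1)]))
  have h₂ : spFreq ζ ≤ ζ 0 + ζ 1 ^ 2 := by
    have : 1 ≤ ζ 0 := by linarith
    rw [spFreq, Real.sqrt_le_left (by positivity)]
    nlinarith [sq_nonneg (ζ 1)]
  have h₃ : |tFreq ζ + spFreq ζ| ≤ 8 * L := by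
    rw [tFreq, abs_le]
    constructor <;> linarith
  linarith

theorem sqrt_volume_le_of_bilinear_estimate {k ℓ b' b₁ b₂ C : ℝ}
    (hC : ∀ u v : SchwartzMap SpaceTime ℂ,
      XSn k (-b') (fun ζ => u ζ * v ζ) ≤ ENNReal.ofReal C * XWn ℓ b₁ ⇑v * XSn k b₂ ⇑u)
    {N L : ℝ} (hN : 16 ≤ N) (hL : 1 ≤ L) (hLN : L ≤ N) :
    √(L / N * √L * L) ≤
      64 * C * 16 ^ (2 * |k| + |ℓ|) * N ^ ℓ * (16 * L) ^ (|b'| + |b₁| + |b₂|) := by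
  have hN0 : 0 < N := by linarith
  have hL0 : 0 < L := by linarith
  set r := radii N L with hr
  have r0 : ∀ i, 0 < r i := by
    intro i
    fin_cases i <;> simp [hr, radii] <;> positivity
  have r2 : ∀ i, 0 ≤ ((2 : ℝ) • r) i := fun i => by simpa using (r0 i).le
  have rh : ∀ i, 0 ≤ ((1 / 2 : ℝ) • r) i := fun i => by simpa using (r0 i).le
  set V := L / N * √L * L with hV
  have V0 : 0 < V := by positivity
  have hVr : ∏ i, r i = V := by simp [hr, radii, Fin.prod_univ_three, hV]
  have hVh : ∏ i, 2 * ((1 / 2 : ℝ) • r) i = V := by simp [← hVr]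
  have hV2 : ∏ i, 2 * ((2 : ℝ) • r) i = 64 * V := by
    simp only [← hVr, Fin.prod_univ_three, Pi.smul_apply, smul_eq_mul]
    ring
  obtain ⟨u, v, hu, hv, huv⟩ := exists_schwartz_pair ![-((N - 1) / 2), 0, -(-((N - 1) / 2)) ^ 2]
    ![N, 0, -N] r r0
  have hc : (![-((N - 1) / 2), 0, -(-((N - 1) / 2)) ^ 2] + ![N, 0, -N] : Fin 3 → ℝ) =
      ![(N + 1) / 2, 0, -((N + 1) / 2) ^ 2] := by
    ext i
    fin_cases i <;> simp <;> ring
  rw [hc] at huv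
  have hS : ∀ (a b : ℝ) (ζ : SpaceTime), (N - 1) / 2 ≤ |a| → |a| ≤ (N + 1) / 2 →
      ζ ∈ box ![a, 0, -a ^ 2] ((2 : ℝ) • r) →
      wS k b ζ ≤ 16 ^ |k| * N ^ k * (16 * L) ^ |b| ∧
        N ^ k ≤ 16 ^ |k| * (16 * L) ^ |b| * wS k b ζ := by
    intro a b ζ h₁ h₂ hζ
    obtain ⟨e₁, e₂⟩ := jap_spFreq_bounds hN hL hLN h₁ (by linarith) hζ
    exact weight_bounds k b hN0 e₁ e₂ (jap_schrodinger_modulation_le hN hL hLN h₂ hζ)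
  have hW : ∀ ζ ∈ box ![N, 0, -N] ((2 : ℝ) • r),
      wW ℓ b₁ ζ ≤ 16 ^ |ℓ| * N ^ ℓ * (16 * L) ^ |b₁| := by
    intro ζ hζ
    have hNa : |N| = N := abs_of_pos hN0
    obtain ⟨e₁, e₂⟩ := jap_spFreq_bounds hN hL hLN (by linarith) hNa.le hζ
    exact (weight_bounds ℓ b₁ hN0 e₁ e₂ (jap_wave_modulation_le hN hL hLN hζ)).1
  have hj : ∀ x, 0 ≤ jap x := fun x => zero_le_one.trans (one_le_jap x)
  have hS0 : ∀ b ζ, 0 ≤ wS k b ζ := fun b ζ =>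
    mul_nonneg (Real.rpow_nonneg (hj _) _) (Real.rpow_nonneg (hj _) _)
  have hW0 : ∀ ζ, 0 ≤ wW ℓ b₁ ζ := fun ζ =>
    mul_nonneg (Real.rpow_nonneg (hj _) _) (Real.rpow_nonneg (hj _) _)
  have upper : ∀ (w : SpaceTime → ℝ) (f : SpaceTime → ℂ) (c : Fin 3 → ℝ) (M : ℝ), 0 ≤ M →
      (∀ ζ, 0 ≤ w ζ) → (∀ ζ ∈ box c ((2 : ℝ) • r), w ζ ≤ M) →
      (∀ ζ, ‖f ζ‖ ≤ (box c ((2 : ℝ) • r)).indicator 1 ζ) →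
      eLpNorm (fun ζ => (w ζ : ℂ) * f ζ) 2 volume ≤ ENNReal.ofReal (M * √(64 * V)) := by
    intro w f c M hM hw hwM hf
    rw [← hV2]
    refine eLpNorm_two_le_of_box (c := c) r2 hM fun ζ => ?_
    rw [norm_mul, Complex.norm_real, Real.norm_of_nonneg (hw ζ)]
    by_cases hζ : ζ ∈ box c ((2 : ℝ) • r)
    · have := hf ζ
      rw [Set.indicator_of_mem hζ] at this ⊢
      simpa using mul_le_mul (hwM ζ hζ) this (norm_nonneg _) hM
    · have := hf ζ
      rw [Set.indicator_of_notMem hζ] at this ⊢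
      exact mul_nonpos_of_nonneg_of_nonpos (hw ζ) this
  have ha : |(-((N - 1) / 2))| = (N - 1) / 2 := by
    rw [abs_neg, abs_of_nonneg (by linarith)]
  have ha' : |(N + 1) / 2| = (N + 1) / 2 := abs_of_nonneg (by linarith)
  have hU := upper (wS k b₂) _ _ (16 ^ |k| * N ^ k * (16 * L) ^ |b₂|) (by positivity) (hS0 b₂)
    (fun ζ hζ => (hS _ b₂ ζ ha.ge (by linarith) hζ).1) hu
  have hVv := upper (wW ℓ b₁) _ _ (16 ^ |ℓ| * N ^ ℓ * (16 * L) ^ |b₁|) (by positivity) hW0 hW hv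
  have hlow : ENNReal.ofReal (N ^ k / (16 ^ |k| * (16 * L) ^ |b'|) * V * √V) ≤
      XSn k (-b') (fun ζ => u ζ * v ζ) := by
    rw [← hVh]
    refine le_eLpNorm_two_of_box (c := ![(N + 1) / 2, 0, -((N + 1) / 2) ^ 2]) rh
      (by rw [hVh]; positivity) fun ζ hζ => ?_
    rw [norm_mul, Complex.norm_real, Real.norm_of_nonneg (hS0 _ ζ), hVh, ← hVr]
    refine mul_le_mul ?_ (huv ζ hζ) (by rw [hVr]; exact V0.le) (hS0 _ ζ)
    rw [div_le_iff₀' (by positivity), ← abs_neg b']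
    refine (hS _ (-b') ζ (by linarith) ha'.le fun i => (hζ i).trans ?_).2
    simp only [Pi.smul_apply, smul_eq_mul]
    linarith [r0 i]
  have key : ENNReal.ofReal (N ^ k / (16 ^ |k| * (16 * L) ^ |b'|) * V * √V) ≤
      ENNReal.ofReal (C * (16 ^ |ℓ| * N ^ ℓ * (16 * L) ^ |b₁| * √(64 * V)) *
        (16 ^ |k| * N ^ k * (16 * L) ^ |b₂| * √(64 * V))) := by
    refine ((hlow.trans (hC u v)).trans (mul_le_mul' (mul_le_mul' le_rfl hVv) hU)).trans_eq ?_
    rw [← ENNReal.ofReal_mul' (by positivity), ← ENNReal.ofReal_mul' (by positivity)]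
  have key' := (ENNReal.ofReal_le_ofReal_iff'.1 key).resolve_right (not_le.2 (by positivity))
  have h64 : √(64 * V) * √(64 * V) = 64 * V := Real.mul_self_sqrt (by positivity)
  have hfac : 0 < N ^ k * V / (16 ^ |k| * (16 * L) ^ |b'|) := by positivity
  refine le_of_mul_le_mul_left ?_ hfac
  rw [Real.rpow_add (by norm_num), Real.rpow_add (by positivity), Real.rpow_add (by positivity),
    two_mul, Real.rpow_add (by norm_num)]
  calc _ = N ^ k / (16 ^ |k| * (16 * L) ^ |b'|) * V * √V := by ring
    _ ≤ _ := key'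
    _ = C * (16 ^ |ℓ| * N ^ ℓ * (16 * L) ^ |b₁|) * (16 ^ |k| * N ^ k * (16 * L) ^ |b₂|) *
        (√(64 * V) * √(64 * V)) := by ring
    _ = _ := by
      rw [h64]
      field_simp

theorem not_forall_rpow_le_mul_rpow {p q : ℝ} (hpq : q < p) (Q : ℝ) :
    ¬ ∀ N : ℝ, 16 ≤ N → N ^ p ≤ Q * N ^ q := by
  intro h
  obtain ⟨N, hN, hNQ⟩ := ((Filter.eventually_ge_atTop 16).and
    ((tendsto_rpow_atTop (sub_pos.2 hpq)).eventually_gt_atTop Q)).exists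
  have hN0 : 0 < N := by linarith
  rw [Real.rpow_sub hN0, lt_div_iff₀ (by positivity)] at hNQ
  exact (h N hN).not_gt hNQ

/-- Failure of the Schrödinger bilinear estimate below the threshold. -/
theorem failure_schrodinger_bilinear (k ℓ b' b₁ b₂ : ℝ)
    (h : ℓ < -(1 / 2) ∨
      (ℓ = -(1 / 2) ∧ 0 ≤ b' ∧ 0 ≤ b₁ ∧ 0 ≤ b₂ ∧ b' + b₁ + b₂ < 5 / 4)) :
    ¬ ∃ C : ℝ, ∀ u v : SchwartzMap SpaceTime ℂ,
        XSn k (-b') (fun ζ => u ζ * v ζ) ≤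
          ENNReal.ofReal C * XWn ℓ b₁ ⇑v * XSn k b₂ ⇑u := by
  rintro ⟨C, hC⟩
  rcases h with hl | ⟨rfl, h', h₁, h₂, hb⟩
  · refine not_forall_rpow_le_mul_rpow hl
      (64 * C * 16 ^ (2 * |k| + |ℓ|) * 16 ^ (|b'| + |b₁| + |b₂|)) fun N hN => ?_
    have hN0 : 0 ≤ N := by linarith
    have := sqrt_volume_le_of_bilinear_estimate hC hN le_rfl (by linarith)
    rw [Real.sqrt_one, mul_one, mul_one, mul_one, one_div, Real.sqrt_inv, Real.sqrt_eq_rpow,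
      ← Real.rpow_neg hN0] at this
    linarith
  · refine not_forall_rpow_le_mul_rpow (p := 3 / 4) (q := -(1 / 2) + (b' + b₁ + b₂))
      (by linarith)
      (64 * C * 16 ^ (2 * |k| + |-(1 / 2 : ℝ)|) * 16 ^ (b' + b₁ + b₂)) fun N hN => ?_
    have hN0 : 0 < N := by linarith
    have := sqrt_volume_le_of_bilinear_estimate hC hN (by linarith) le_rfl
    rw [div_self hN0.ne', one_mul, abs_of_nonneg h', abs_of_nonneg h₁, abs_of_nonneg h₂,
      Real.mul_rpow (by norm_num) hN0.le, Real.sqrt_eq_rpow, Real.sqrt_eq_rpow,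
      ← Real.rpow_add_one hN0.ne', ← Real.rpow_mul hN0.le] at this
    rw [Real.rpow_add hN0]
    norm_num at this ⊢
    linarith
end
end
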